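/- arXiv:2002.05288 — 4 statements merged into one kernel-verified Lean document; each statement's English description precedes it below -/
import Mathlib

section
/- Let G be a simple graph in which every cycle has length divisible by 4, and let {V_α, V_β} be a bipartition of its vertex set. If C is a 2-connected subgraph of G and P is a C-path (a nontrivial path meeting C exactly in its two endpoints), then both endpoints of P lie in the same part of the bipartition (both are of type α or both are of type β). -/
open SimpleGraph

/-- A graph has *multi-4-cycles* if every cycle has length divisible by `4`. -/
def Multi4 {V : Type*} (G : SimpleGraph V) : Prop :=
  ∀ ⦃u : V⦄ (c : G.Walk u u), c.IsCycle → 4 ∣ c.length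

/-- `A` and its complement form a bipartition of `G`: every edge joins `A` (type α)
to its complement (type β). -/
def Bipartition {V : Type*} (G : SimpleGraph V) (A : Set V) : Prop :=
  ∀ ⦃u w : V⦄, G.Adj u w → (u ∈ A ↔ w ∉ A)

/-- A graph is 2-connected: connected, at least three vertices, and no cut vertex. -/
def TwoConn {W : Type*} (G : SimpleGraph W) : Prop :=
  G.Connected ∧ (∃ a b c : W, a ≠ b ∧ a ≠ c ∧ b ≠ c) ∧
    ∀ v : W, (G.induce ({v}ᶜ : Set W)).Preconnected

/-- The set of inner vertices of a walk from `x` to `y`. -/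
def innSet {W : Type*} {G : SimpleGraph W} {x y : W} (P : G.Walk x y) : Set W :=
  {w | w ∈ P.support ∧ w ≠ x ∧ w ≠ y}

namespace SimpleGraph

variable {W : Type*} {H : SimpleGraph W}

/-- A walk that ends in `S` has an initial part, which can be taken to be a path, that meets `S`
only in its last vertex. -/
lemma Walk.exists_isPath_first_mem {S : Set W} {a b : W} (p : H.Walk a b) (hb : b ∈ S) :
    ∃ z ∈ S, ∃ q : H.Walk a z, q.IsPath ∧ q.support ⊆ p.support ∧
      ∀ v ∈ q.support, v ∈ S → v = z := by
  classical
  suffices h : ∃ z ∈ S, ∃ q : H.Walk a z, q.support ⊆ p.support ∧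
      ∀ v ∈ q.support, v ∈ S → v = z by
    obtain ⟨z, hz, q, hqp, hq⟩ := h
    exact ⟨z, hz, q.bypass, q.bypass_isPath, fun v hv => hqp (q.support_bypass_subset_support hv),
      fun v hv => hq v (q.support_bypass_subset_support hv)⟩
  induction p with
  | nil => exact ⟨_, hb, .nil, by simp, by simp⟩
  | @cons u _ _ h p ih =>
    by_cases hu : u ∈ S
    · exact ⟨u, hu, .nil, by simp, by simp⟩
    · obtain ⟨z, hz, q, hqp, hq⟩ := ih hb
      refine ⟨z, hz, .cons h q, ?_, ?_⟩
      · simpa using List.cons_subset_cons u hqp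
      · intro v hv hvS
        rw [Walk.support_cons, List.mem_cons] at hv
        rcases hv with rfl | hv
        · exact absurd hvS hu
        · exact hq v hv hvS

lemma Preconnected.exists_walk_notMem_support {w a b : W}
    (h : (H.induce ({w}ᶜ : Set W)).Preconnected) (ha : a ≠ w) (hb : b ≠ w) :
    ∃ p : H.Walk a b, w ∉ p.support := by
  obtain ⟨p⟩ := h ⟨a, ha⟩ ⟨b, hb⟩
  let f := (Embedding.induce (G := H) ({w}ᶜ : Set W)).toHom
  refine ⟨p.map f, fun hw => ?_⟩
  obtain ⟨v, -, hv⟩ := List.mem_map.1 ((p.support_map f) ▸ hw)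
  exact v.2 hv

/-- Two vertices of a cycle, one of them the base point `w`, are joined by an arc of the cycle
through any prescribed vertex `x` of the cycle. -/
lemma Walk.IsCycle.exists_isPath_mem_support {w x z : W} {c : H.Walk w w} (hc : c.IsCycle)
    (hx : x ∈ c.support) (hz : z ∈ c.support) (hzw : z ≠ w) :
    ∃ p : H.Walk w z, p.IsPath ∧ x ∈ p.support ∧ p.support ⊆ c.support := by
  classical
  have hx' := hx
  rw [← c.take_spec hz, Walk.mem_support_append_iff] at hx'
  rcases hx' with h | h
  · exact ⟨_, hc.isPath_takeUntil hz, h, c.support_takeUntil_subset_support hz⟩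
  · have hc' := hc
    rw [← c.take_spec hz] at hc'
    refine ⟨(c.dropUntil z hz).reverse,
      (hc'.isPath_of_append_right (Walk.not_nil_of_ne hzw.symm)).reverse, by simpa using h, ?_⟩
    intro v hv
    rw [Walk.support_reverse, List.mem_reverse] at hv
    exact c.support_dropUntil_subset_support hz hv

/-- A cycle through `x` and `w` can be rerouted through a neighbour `y` of `w`, if `y` can be
joined to the cycle avoiding `w`. -/
lemma exists_isCycle_mem_support_of_adj (h2 : ∀ v : W, (H.induce ({v}ᶜ : Set W)).Preconnected)
    {x w y : W} (hwy : H.Adj w y) {c : H.Walk x x} (hc : c.IsCycle) (hw : w ∈ c.support) :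
    ∃ c' : H.Walk x x, c'.IsCycle ∧ y ∈ c'.support := by
  classical
  by_cases hy : y ∈ c.support
  · exact ⟨c, hc, hy⟩
  have hrot (v : W) : v ∈ (c.rotate w hw).support ↔ v ∈ c.support := by simp
  obtain ⟨u, hu, huw⟩ : ∃ u ∈ c.support, u ≠ w := by
    by_cases hxw : x = w
    · exact ⟨c.snd, c.getVert_mem_support 1, hxw ▸ (c.adj_snd hc.not_nil).ne'⟩
    · exact ⟨x, c.start_mem_support, hxw⟩
  obtain ⟨R, hR⟩ := (h2 w).exists_walk_notMem_support hwy.ne' huw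
  obtain ⟨z, hz, q, hq, hqR, hqz⟩ := R.exists_isPath_first_mem (S := {v | v ∈ c.support}) hu
  have hzw : z ≠ w := fun h => hR (h ▸ hqR q.end_mem_support)
  obtain ⟨p, hp, hxp, hpc⟩ := (hc.rotate hw).exists_isPath_mem_support
    ((hrot x).2 c.start_mem_support) ((hrot z).2 hz) hzw
  have hpc' : ∀ v ∈ p.support, v ∈ c.support := fun v hv => (hrot v).1 (hpc hv)
  have hcyc : ((Walk.cons hwy.symm p).append q.reverse).IsCycle := by
    refine Walk.IsPath.isCycle_append (hp.cons fun h => hy (hpc' y h)) hq.reverse ?_ (.inl ?_)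
    · intro v hv hvq
      rw [Walk.support_cons, List.tail_cons] at hv
      have hvz : v = z := hqz v (by simpa using List.mem_of_mem_tail hvq) (hpc' v hv)
      have hnd := hq.reverse.support_nodup
      rw [← Walk.cons_tail_support, List.nodup_cons] at hnd
      exact hnd.1 (hvz ▸ hvq)
    · have := Walk.not_nil_iff_lt_length.1 (Walk.not_nil_of_ne (p := p) hzw.symm)
      rw [Walk.length_cons]
      omega
  have hx : x ∈ ((Walk.cons hwy.symm p).append q.reverse).support := by
    simp [Walk.mem_support_append_iff, hxp]
  exact ⟨_, hcyc.rotate hx, by simp⟩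

lemma Walk.mk_mem_edges_of_length_eq_one {a b : W} (p : H.Walk a b) (h : p.length = 1) :
    s(a, b) ∈ p.edges := by
  match p, h with
  | .cons _ .nil, _ => simp

end SimpleGraph

namespace TwoConn

variable {W : Type*} {H : SimpleGraph W}

lemma exists_isCycle (hH : TwoConn H) (x : W) : ∃ c : H.Walk x x, c.IsCycle := by
  obtain ⟨hconn, ⟨r, s, t, hrs, hrt, hst⟩, h2⟩ := hH
  have : Nontrivial W := ⟨r, s, hrs⟩
  obtain ⟨a, hxa⟩ := hconn.preconnected.exists_adj_of_nontrivial x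
  obtain ⟨v, hvx, hva⟩ : ∃ v : W, v ≠ x ∧ v ≠ a := by
    by_contra! h
    by_cases hr : r = x
    · exact hst ((h s fun hs => hrs (hr.trans hs.symm)).trans
        (h t fun ht => hrt (hr.trans ht.symm)).symm)
    · by_cases hs : s = x
      · exact hrt ((h r hr).trans (h t fun ht => hst (hs.trans ht.symm)).symm)
      · exact hrs ((h r hr).trans (h s hs).symm)
  obtain ⟨p, hp⟩ := (h2 a).exists_walk_notMem_support hxa.ne hva
  have hnil : ¬ p.Nil := Walk.not_nil_of_ne hvx.symm
  have hxb : H.Adj x p.snd := p.adj_snd hnil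
  have hba : p.snd ≠ a := fun h => hp (h ▸ p.getVert_mem_support 1)
  obtain ⟨q, hq⟩ := (h2 x).exists_walk_notMem_support hxb.ne' hxa.ne'
  classical
  have hq' : x ∉ q.bypass.support := fun h => hq (q.support_bypass_subset_support h)
  refine ⟨((Walk.cons hxb q.bypass).append (.cons hxa.symm .nil)),
    Walk.IsPath.isCycle_append (q.bypass_isPath.cons hq') (by simp [hxa.ne']) ?_ (.inl ?_)⟩
  · simpa using hq'
  · have := Walk.not_nil_iff_lt_length.1 (Walk.not_nil_of_ne (p := q.bypass) hba)
    rw [Walk.length_cons]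
    omega

/-- Any two vertices of a 2-connected graph lie on a common cycle. -/
lemma exists_isCycle_mem_support (hH : TwoConn H) (x y : W) :
    ∃ c : H.Walk x x, c.IsCycle ∧ y ∈ c.support := by
  obtain ⟨p⟩ := hH.1.preconnected y x
  induction p with
  | nil =>
    obtain ⟨c, hc⟩ := hH.exists_isCycle _
    exact ⟨c, hc, c.start_mem_support⟩
  | cons h _ ih =>
    obtain ⟨c, hc, hw⟩ := ih
    exact exists_isCycle_mem_support_of_adj hH.2.2 h.symm hc hw

end TwoConn

lemma Bipartition.even_length_iff {V : Type*} {G : SimpleGraph V} {A : Set V}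
    (hbip : Bipartition G A) {x y : V} (p : G.Walk x y) :
    Even p.length ↔ (x ∈ A ↔ y ∈ A) := by
  induction p with
  | nil => simp
  | cons h p ih =>
    have := hbip h
    rw [Walk.length_cons, Nat.even_add_one]
    tauto

/-- A `C`-path closes up to a cycle with any path of `C` joining its ends. -/
lemma SimpleGraph.Walk.IsPath.exists_isCycle_of_coe {V : Type*} {G : SimpleGraph V}
    {C : G.Subgraph} {x y : C.verts} {P : G.Walk x y} (hP : P.IsPath) (hxy : x ≠ y)
    (hmeet : ∀ w ∈ P.support, w ∈ C.verts → w = x ∨ w = y)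
    (hedges : ∀ e ∈ P.edges, e ∉ C.edgeSet) {Q : C.coe.Walk y x} (hQ : Q.IsPath) :
    ∃ c : G.Walk x x, c.IsCycle ∧ c.length = P.length + Q.length := by
  obtain ⟨Q', hQ', hlen, hsupp⟩ : ∃ Q' : G.Walk (y : V) x, Q'.IsPath ∧ Q'.length = Q.length ∧
      ∀ v ∈ Q'.support, v ∈ C.verts := by
    refine ⟨Q.map C.hom, hQ.map C.hom_injective, Q.length_map _, fun v hv => ?_⟩
    obtain ⟨u, -, rfl⟩ := List.mem_map.1 ((Q.support_map C.hom) ▸ hv)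
    exact u.2
  refine ⟨P.append Q', hP.isCycle_append hQ' ?_ ?_, by rw [Walk.length_append, hlen]⟩
  · intro v hvP hvQ
    have hPn := hP.support_nodup
    have hQn := hQ'.support_nodup
    rw [← Walk.cons_tail_support, List.nodup_cons] at hPn hQn
    rcases hmeet v (List.mem_of_mem_tail hvP) (hsupp v (List.mem_of_mem_tail hvQ)) with rfl | rfl
    · exact hPn.1 hvP
    · exact hQn.1 hvQ
  · have hPl := Walk.not_nil_iff_lt_length.1
      (Walk.not_nil_of_ne (p := P) fun h => hxy (Subtype.ext h))
    have hQl := Walk.not_nil_iff_lt_length.1 (Walk.not_nil_of_ne (p := Q) hxy.symm)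
    by_contra! hle
    have hadj : C.Adj y x := Walk.adj_of_length_eq_one (p := Q) (by omega)
    have hPe : s((x : V), (y : V)) ∈ P.edges :=
      P.mk_mem_edges_of_length_eq_one (by omega)
    exact hedges _ hPe hadj.symm

/-- Lemma 2.1.  In a graph with multi-4-cycles with bipartition
`{A, Aᶜ}`, if `C` is a 2-connected subgraph and `P` is a `C`-path (a nontrivial path
meeting `C` exactly in its two endpoints), then both endpoints of `P` are of the same
type. -/
theorem cPath_ends_same_type {V : Type*} (G : SimpleGraph V) (A : Set V)
    (hG : Multi4 G) (hbip : Bipartition G A)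
    (C : G.Subgraph) (hC : TwoConn C.coe)
    {x y : V} (P : G.Walk x y) (hP : P.IsPath) (hlen : 1 ≤ P.length)
    (hxC : x ∈ C.verts) (hyC : y ∈ C.verts)
    (hmeet : ∀ w ∈ P.support, w ∈ C.verts → w = x ∨ w = y)
    (hedges : ∀ e ∈ P.edges, e ∉ C.edgeSet) :
    (x ∈ A ↔ y ∈ A) := by
  classical
  have hxy : x ≠ y := by
    rintro rfl
    rw [Walk.isPath_iff_nil.1 hP |>.eq_nil] at hlen
    simp at hlen
  have hxy' : (⟨x, hxC⟩ : C.verts) ≠ ⟨y, hyC⟩ := fun h => hxy (congrArg Subtype.val h)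
  obtain ⟨c, hc, hy⟩ := hC.exists_isCycle_mem_support ⟨x, hxC⟩ ⟨y, hyC⟩
  have hc' := hc
  rw [← c.take_spec hy] at hc'
  obtain ⟨c₁, hc₁, hl₁⟩ := Walk.IsPath.exists_isCycle_of_coe (x := ⟨x, hxC⟩) (y := ⟨y, hyC⟩)
    hP hxy' hmeet hedges (hc.isPath_takeUntil hy).reverse
  obtain ⟨c₂, hc₂, hl₂⟩ := Walk.IsPath.exists_isCycle_of_coe (x := ⟨x, hxC⟩) (y := ⟨y, hyC⟩)
    hP hxy' hmeet hedges (hc'.isPath_of_append_right (Walk.not_nil_of_ne hxy'))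
  have h₁ := hG _ hc₁
  have h₂ := hG _ hc₂
  have h₃ := hG _ (hc'.map C.hom_injective)
  rw [Walk.length_map, Walk.length_append] at h₃
  rw [Walk.length_reverse] at hl₁
  rw [← hbip.even_length_iff P, Nat.even_iff]
  omega
end

section
/- Let G be a 2-connected simple graph in which every cycle has length divisible by 4, with vertex bipartition {V_α, V_β}. Let P be an x–y path in G all of whose inner vertices have degree 2 in G, whose endpoints x and y are of different types, and both x and y have degree at least 3 in G. Then there exist a sequence B_1, B_2, ..., B_{n+1} (n ≥ 1) of blocks of the graph G − Int P and a sequence a_1, a_2, ..., a_n of cut vertices such that G − Int P = B_1 ∪ ... ∪ B_{n+1}, the blocks B_1 and B_{n+1} are 2-connected, x ∈ B_1, y ∈ B_{n+1}, B_i ∩ B_{i+1} = {a_i} for each i = 1, ..., n, a_1 ≠ x, and a_n ≠ y. -/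
open SimpleGraph

/-- A graph has no cut vertex: deleting any single vertex leaves it preconnected. -/
def NoCutVertex {W : Type*} (G : SimpleGraph W) : Prop :=
  ∀ v : W, (G.induce ({v}ᶜ : Set W)).Preconnected

/-- `B` is a block of the subgraph `H` of `G`: a maximal connected subgraph of `H`
having no cut vertex. -/
def IsBlockOf {V : Type*} (G : SimpleGraph V) (B H : G.Subgraph) : Prop :=
  B ≤ H ∧ B.coe.Connected ∧ NoCutVertex B.coe ∧
    ∀ B' : G.Subgraph, B ≤ B' → B' ≤ H → B'.coe.Connected → NoCutVertex B'.coe → B' = B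

/-- The graph `G − Int P`: for a path of length at least `2` we delete the inner
vertices of `P`; for a path of length `1` we delete the edge of `P`. -/
def removeInt {V : Type*} {G : SimpleGraph V} {x y : V} (P : G.Walk x y) : G.Subgraph :=
  ((⊤ : G.Subgraph).deleteVerts (innSet P)).deleteEdges
    (if P.length = 1 then {e | e ∈ P.edges} else (∅ : Set (Sym2 V)))

namespace SimpleGraph.Walk

variable {V : Type*} {G : SimpleGraph V}

theorem exists_last_mem {u v : V} (p : G.Walk u v) {S : Set V} (h : ∃ t ∈ p.support, t ∈ S) :
    ∃ z ∈ S, ∃ r : G.Walk z v, r.support ⊆ p.support ∧ ∀ t ∈ r.support, t ∈ S → t = z := by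
  induction p with
  | nil => exact ⟨_, by simpa using h, .nil, by simp, by simp⟩
  | @cons a b c hab p ih =>
    by_cases hp : ∃ t ∈ p.support, t ∈ S
    · obtain ⟨z, hz, r, hr, hrS⟩ := ih hp
      exact ⟨z, hz, r, fun t ht => by simp [hr ht], hrS⟩
    · push Not at hp
      obtain ⟨t, ht, htS⟩ := h
      simp only [support_cons, List.mem_cons] at ht
      obtain rfl := ht.resolve_right fun h' => hp t h' htS
      refine ⟨t, htS, .cons hab p, by simp, fun s hs hsS => ?_⟩
      simp only [support_cons, List.mem_cons] at hs
      exact hs.resolve_right fun h' => hp s h' hsS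

theorem IsPath.isCycle_append_reverse {u v : V} {p q : G.Walk u v} (hp : p.IsPath) (hq : q.IsPath)
    (hne : p ≠ q) (h : ∀ t ∈ p.support, t ∈ q.support → t = u ∨ t = v) :
    (p.append q.reverse).IsCycle := by
  refine hp.isCycle_append ((isPath_reverse_iff q).mpr hq) (fun _ ↦ ?_) ?_
  · grind [dropLast_support_concat, IsPath.support_nodup, support_reverse, cons_tail_support]
  · grind [length_reverse, eq_of_length_le_one]

theorem even_length_iff_of_bipartition {A : Set V} (hA : ∀ ⦃u w : V⦄, G.Adj u w → (u ∈ A ↔ w ∉ A))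
    {u v : V} (p : G.Walk u v) : Even p.length ↔ (u ∈ A ↔ v ∈ A) := by
  induction p with
  | nil => simp
  | cons h p ih =>
    have := hA h
    rw [length_cons, Nat.even_add_one, ih]
    tauto

/-- In a graph where no single vertex separates two vertices of `U`, and where `U` has a third
vertex, any two adjacent-reachable vertices are joined by two distinct internally disjoint paths. -/
theorem exists_two_internally_disjoint {U : Set V} (hU : ∀ ⦃a b : V⦄, G.Adj a b → b ∈ U)
    (hsep : ∀ v, ∀ a ∈ U, ∀ b ∈ U, a ≠ v → b ≠ v → ∃ p : G.Walk a b, v ∉ p.support)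
    {x y : V} (hx : x ∈ U) (hthird : ∀ a, ∃ z ∈ U, z ≠ x ∧ z ≠ a) (hxy : x ≠ y)
    (hr : Relation.ReflTransGen G.Adj x y) :
    ∃ p q : G.Walk x y, p.IsPath ∧ q.IsPath ∧ p ≠ q ∧
      ∀ t ∈ p.support, t ∈ q.support → t = x ∨ t = y := by
  classical
  induction hr with
  | refl => exact absurd rfl hxy
  | @tail w y hw hwy ih =>
    have hyU := hU hwy
    by_cases hxw : x = w
    · subst hxw
      obtain ⟨z, hz, hzx, hzy⟩ := hthird y
      obtain ⟨r, hr⟩ := hsep y x hx z hz hxy hzy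
      obtain ⟨s, hs⟩ := hsep x z hz y hyU hzx hxy.symm
      refine ⟨hwy.toWalk, (r.append s).bypass, by simp [hxy], bypass_isPath _, fun h => ?_, ?_⟩
      · have : s(x, y) ∈ (r.append s).edges :=
          edges_bypass_subset_edges _ (h ▸ by simp)
        rw [edges_append, List.mem_append] at this
        rcases this with h | h
        · exact hr (snd_mem_support_of_mem_edges _ h)
        · exact hs (fst_mem_support_of_mem_edges _ h)
      · simp
    · have hyw : y ≠ w := hwy.ne.symm
      have key : ∀ p q : G.Walk x w, p.IsPath → q.IsPath →
          (∀ t ∈ p.support, t ∈ q.support → t = x ∨ t = w) →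
          ∀ z ∈ p.support, z ≠ w → ∀ r : G.Walk z y, w ∉ r.support →
          (∀ t ∈ r.support, t ∈ p.support ∨ t ∈ q.support → t = z) →
          ∃ p q : G.Walk x y, p.IsPath ∧ q.IsPath ∧ p ≠ q ∧
            ∀ t ∈ p.support, t ∈ q.support → t = x ∨ t = y := by
        intro p q hp hq hpq z hz hzw r hwr hr
        have hyq : y ∉ q.support := by
          intro h
          have := hr y r.end_mem_support (.inr h)
          have := hpq y (this ▸ hz) h
          grind
        have hwt := endpoint_notMem_support_takeUntil hp hz hzw.symm
        have hsub : ∀ t ∈ ((p.takeUntil z hz).append r).bypass.support,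
            t ∈ (p.takeUntil z hz).support ∨ t ∈ r.support := fun t ht => by
          have := support_bypass_subset_support _ ht
          rwa [mem_support_append_iff] at this
        refine ⟨((p.takeUntil z hz).append r).bypass, q.concat hwy, bypass_isPath _,
          hq.concat hyq hwy, fun h => ?_, fun t ht htq => ?_⟩
        · have : w ∈ ((p.takeUntil z hz).append r).bypass.support := by
            rw [h, support_concat]; simp
          rcases hsub w this with h | h
          · exact hwt h
          · exact hwr h
        · rw [support_concat] at htq
          simp only [List.mem_append, List.mem_singleton] at htq
          rcases htq with htq | htq
          · left
            have htz : t ∈ (p.takeUntil z hz).support := by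
              rcases hsub t ht with h | h
              · exact h
              · rw [hr t h (.inr htq)]
                exact end_mem_support _
            refine (hpq t (p.support_takeUntil_subset_support hz htz) htq).resolve_right ?_
            rintro rfl
            exact hwt htz
          · exact .inr htq
      obtain ⟨p, q, hp, hq, -, hpq⟩ := ih hxw
      obtain ⟨R, hR⟩ := hsep w x hx y hyU hxw hyw
      obtain ⟨z, hz, r, hrR, hr⟩ := R.exists_last_mem (S := {t | t ∈ p.support ∨ t ∈ q.support})
        ⟨x, start_mem_support _, .inl (start_mem_support _)⟩
      have hwr : w ∉ r.support := fun h => hR (hrR h)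
      have hzw : z ≠ w := fun h => hwr (h ▸ start_mem_support _)
      rcases hz with hz | hz
      · exact key p q hp hq hpq z hz hzw r hwr hr
      · exact key q p hq hp (fun t h h' => hpq t h' h) z hz hzw r hwr
          fun t h h' => hr t h h'.symm

end SimpleGraph.Walk

namespace SimpleGraph.Subgraph

variable {V : Type*} {G : SimpleGraph V} {H : G.Subgraph} {S : Set V} {u v w x y : V}

/-- `w` can be reached from `u` along edges of `H` all of whose ends avoid `S`. -/
def ReachAvoiding (H : G.Subgraph) (S : Set V) : V → V → Prop :=
  Relation.ReflTransGen fun a b => H.Adj a b ∧ a ∉ S ∧ b ∉ S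

theorem ReachAvoiding.symm (h : H.ReachAvoiding S u w) : H.ReachAvoiding S w u := by
  induction h with
  | refl => exact .refl
  | tail _ h ih => exact .head ⟨h.1.symm, h.2.2, h.2.1⟩ ih

theorem ReachAvoiding.trans (h : H.ReachAvoiding S u v) (h' : H.ReachAvoiding S v w) :
    H.ReachAvoiding S u w :=
  Relation.ReflTransGen.trans h h'

theorem ReachAvoiding.mono {H' : G.Subgraph} {S' : Set V} (hH : H ≤ H')
    (hS : ∀ a ∈ H.verts, a ∉ S → a ∉ S') (h : H.ReachAvoiding S u w) :
    H'.ReachAvoiding S' u w :=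
  Relation.ReflTransGen.mono (fun _ _ h => ⟨hH.2 h.1, hS _ h.1.fst_mem h.2.1,
    hS _ h.1.snd_mem h.2.2⟩) _ _ h

theorem ReachAvoiding.eq_or_notMem (h : H.ReachAvoiding S u w) : u = w ∨ w ∉ S := by
  rcases Relation.ReflTransGen.cases_tail h with h | ⟨_, _, h⟩
  · exact .inl h.symm
  · exact .inr h.2.2

theorem ReachAvoiding.mem_verts (h : H.ReachAvoiding S u w) (hu : u ∈ H.verts) : w ∈ H.verts := by
  rcases Relation.ReflTransGen.cases_tail h with h | ⟨_, _, h⟩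
  · exact h ▸ hu
  · exact h.1.snd_mem

/-- Any two vertices of `B` remain joined in `B` after deleting at most one vertex. -/
def Nonseparable (B : G.Subgraph) : Prop :=
  B.verts.Nonempty ∧ ∀ S : Set V, S.Subsingleton → ∀ u ∈ B.verts, ∀ w ∈ B.verts,
    u ∉ S → w ∉ S → B.ReachAvoiding S u w

theorem connected_and_noCutVertex_iff (B : G.Subgraph) :
    B.coe.Connected ∧ NoCutVertex B.coe ↔ B.Nonseparable := by
  constructor
  · rintro ⟨hc, hn⟩
    have hconn : ∀ u ∈ B.verts, ∀ w ∈ B.verts, B.ReachAvoiding ∅ u w := fun u hu w hw =>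
      Relation.ReflTransGen.lift Subtype.val (fun a b h => ⟨h, by simp⟩) _ _
        ((reachable_iff_reflTransGen _ _).mp (hc.preconnected ⟨u, hu⟩ ⟨w, hw⟩))
    refine ⟨Set.nonempty_coe_sort.mp hc.nonempty, fun S hS u hu w hw huS hwS => ?_⟩
    by_cases hSB : ∃ v ∈ S, v ∈ B.verts
    · obtain ⟨v, hvS, hv⟩ := hSB
      have hne : ∀ {a : B.verts}, a ≠ ⟨v, hv⟩ → a.1 ∉ S := fun ha haS =>
        ha (Subtype.ext (hS haS hvS))
      refine Relation.ReflTransGen.lift (r := (B.coe.induce {⟨v, hv⟩}ᶜ).Adj)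
        (p := fun a b => B.Adj a b ∧ a ∉ S ∧ b ∉ S) (fun a => a.1.1)
        (fun a b h => ⟨h, hne a.2, hne b.2⟩) _ _ ((reachable_iff_reflTransGen _ _).mp
          (hn ⟨v, hv⟩ ⟨⟨u, hu⟩, ?_⟩ ⟨⟨w, hw⟩, ?_⟩))
      · intro h
        exact huS (Subtype.mk.inj h ▸ hvS)
      · intro h
        exact hwS (Subtype.mk.inj h ▸ hvS)
    · exact (hconn u hu w hw).mono le_rfl fun a ha _ haS => hSB ⟨a, haS, ha⟩
  · rintro ⟨hne, h⟩
    have hp : B.coe.Preconnected := by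
      rintro ⟨u, hu⟩ ⟨w, hw⟩
      have := h ∅ Set.subsingleton_empty u hu w hw (by simp) (by simp)
      induction this with
      | refl => rfl
      | @tail a b _ hab ih =>
        exact (ih hab.1.fst_mem).trans (Adj.reachable (G := B.coe) hab.1)
    have := hne.to_subtype
    refine ⟨⟨hp⟩, ?_⟩
    rintro ⟨v, hv⟩ ⟨⟨u, hu⟩, huv⟩ ⟨⟨w, hw⟩, hwv⟩
    have hne : ∀ {a : V} {ha : a ∈ B.verts}, a ∉ ({v} : Set V) ↔
        (⟨a, ha⟩ : B.verts) ∈ ({⟨v, hv⟩}ᶜ : Set B.verts) := by simp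
    have := h {v} Set.subsingleton_singleton u hu w hw (hne.mpr huv) (hne.mpr hwv)
    induction this with
    | refl => rfl
    | @tail a b _ hab ih =>
      refine (ih hab.1.fst_mem (hne.mp hab.2.1)).trans (Adj.reachable ?_)
      exact hab.1

theorem isBlockOf_iff {B H : G.Subgraph} : IsBlockOf G B H ↔
    B ≤ H ∧ B.Nonseparable ∧ ∀ B', B ≤ B' → B' ≤ H → B'.Nonseparable → B' = B := by
  simp only [IsBlockOf, ← connected_and_noCutVertex_iff, and_imp, and_assoc]

theorem Nonseparable.isBlockOf_self (h : H.Nonseparable) : IsBlockOf G H H :=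
  isBlockOf_iff.mpr ⟨le_rfl, h, fun _ h h' _ => le_antisymm h' h⟩

/-- `H` is connected and deleting one vertex leaves every other vertex joined to `x` or to `y`:
adding the edge `xy` to `H` would leave no cut vertex. -/
structure NonseparableBetween (H : G.Subgraph) (x y : V) : Prop where
  left_mem : x ∈ H.verts
  right_mem : y ∈ H.verts
  ne : x ≠ y
  reach : ∀ u ∈ H.verts, ∀ w ∈ H.verts, H.ReachAvoiding ∅ u w
  reach_or : ∀ v, ∀ w ∈ H.verts, w ≠ v → H.ReachAvoiding {v} w x ∨ H.ReachAvoiding {v} w y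

theorem NonseparableBetween.symm (h : H.NonseparableBetween x y) : H.NonseparableBetween y x :=
  ⟨h.right_mem, h.left_mem, h.ne.symm, h.reach, fun v w hw hwv => (h.reach_or v w hw hwv).symm⟩

/-- The part of `H` on the side of `x` when it is split at the vertex `v`, with `v` included. -/
def side (H : G.Subgraph) (v x : V) : G.Subgraph :=
  H.induce ({w | H.ReachAvoiding {v} x w} ∪ {v})

theorem side_le (hx : x ∈ H.verts) (hv : v ∈ H.verts) : H.side v x ≤ H := by
  refine ⟨?_, fun _ _ h => h.2.2⟩
  rintro w (hw | rfl)
  · exact hw.mem_verts hx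
  · exact hv

theorem side_adj {a b : V} (hvx : x ≠ v) (ha : H.ReachAvoiding {v} x a) (hab : H.Adj a b) :
    (H.side v x).Adj a b := by
  refine ⟨.inl ha, ?_, hab⟩
  by_cases hb : b = v
  · exact .inr hb
  · refine .inl (Relation.ReflTransGen.tail ha ⟨hab, ?_, hb⟩)
    rcases ha.eq_or_notMem with rfl | h
    exacts [hvx, h]

theorem ReachAvoiding.side (hvx : x ≠ v) (hu : u ∈ (H.side v x).verts)
    (h : H.ReachAvoiding S u w) :
    w ∈ (H.side v x).verts ∧ (H.side v x).ReachAvoiding S u w ∨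
      (H.side v x).ReachAvoiding S u v := by
  induction h with
  | refl => exact .inl ⟨hu, .refl⟩
  | @tail a b _ hab ih =>
    rcases ih with ⟨ha, hr⟩ | h
    · rcases ha with ha | rfl
      · have hab' := side_adj hvx ha hab.1
        exact .inl ⟨hab'.2.1, Relation.ReflTransGen.tail hr ⟨hab', hab.2⟩⟩
      · exact .inr hr
    · exact .inr h

theorem NonseparableBetween.side (h : H.NonseparableBetween x y) (hv : v ∈ H.verts) (hvx : x ≠ v)
    (hvy : y ≠ v) (hxy : ¬ H.ReachAvoiding {v} x y) : (H.side v x).NonseparableBetween x v := by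
  have hx : x ∈ (H.side v x).verts := .inl .refl
  have hle := side_le h.left_mem hv
  have hy : y ∉ (H.side v x).verts := by
    rintro (hy | hy)
    exacts [hxy hy, hvy hy]
  have hxr : ∀ w ∈ (H.side v x).verts, (H.side v x).ReachAvoiding ∅ x w := by
    intro w hw
    rcases (h.reach x h.left_mem w (hle.1 hw)).side hvx hx with h | h'
    · exact h.2
    · rcases hw with hw | rfl
      · clear hxy h'
        induction hw with
        | refl => exact .refl
        | tail ha hab ih => exact .tail ih ⟨side_adj hvx ha hab.1, by simp⟩
      · exact h'
  refine ⟨hx, .inr rfl, hvx, fun u hu w hw => (hxr u hu).symm.trans (hxr w hw),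
    fun u w hw hwu => ?_⟩
  rcases h.reach_or u w (hle.1 hw) hwu with h | h
  · exact (h.side hvx hw).imp_left And.right
  · exact .inr ((h.side hvx hw).resolve_left fun h => hy h.1)

theorem Nonseparable.le_side {B : G.Subgraph} (hB : B.Nonseparable) (hBH : B ≤ H)
    {b : V} (hbB : b ∈ B.verts) (hbv : b ≠ v) (hb : b ∈ (H.side v x).verts) :
    B ≤ H.side v x := by
  have hb : H.ReachAvoiding {v} x b := hb.resolve_right hbv
  have key : ∀ w ∈ B.verts, w ∈ (H.side v x).verts := by
    intro w hw
    by_cases hwv : w = v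
    · exact .inr hwv
    · exact .inl (hb.trans ((hB.2 {v} Set.subsingleton_singleton b hbB w hw hbv hwv).mono hBH
        fun _ _ h => h))
  exact ⟨key, fun a c h => ⟨key a h.fst_mem, key c h.snd_mem, hBH.2 h⟩⟩

theorem isBlockOf_of_side {B : G.Subgraph} (hx : x ∈ H.verts) (hv : v ∈ H.verts)
    (hB : IsBlockOf G B (H.side v x)) (hnt : B.verts.Nontrivial) : IsBlockOf G B H := by
  rw [isBlockOf_iff] at hB ⊢
  refine ⟨hB.1.trans (side_le hx hv), hB.2.1, fun B' hBB' hB'H hB' => hB.2.2 B' hBB' ?_ hB'⟩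
  obtain ⟨b, hb, hbv⟩ := hnt.exists_ne v
  exact hB'.le_side hB'H (hBB'.1 hb) hbv (hB.1.1 hb)

/-- `B 0, …, B m` is a chain of blocks of `H` from `x` to `y`, with union `H`. -/
structure IsBlockChain (H : G.Subgraph) (x y : V) (m : ℕ) (B : ℕ → G.Subgraph) : Prop where
  isBlockOf : ∀ i ≤ m, IsBlockOf G (B i) H
  nontrivial : ∀ i ≤ m, (B i).verts.Nontrivial
  verts_subset : ∀ a ∈ H.verts, ∃ i ≤ m, a ∈ (B i).verts
  adj_subset : ∀ a b, H.Adj a b → ∃ i ≤ m, (B i).Adj a b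
  left_mem : x ∈ (B 0).verts
  right_mem : y ∈ (B m).verts
  inter : ∀ i < m, ∃ a, (B i).verts ∩ (B (i + 1)).verts = {a}
  left_unique : ∀ i ≤ m, x ∈ (B i).verts → i = 0
  right_unique : ∀ i ≤ m, y ∈ (B i).verts → i = m

theorem NonseparableBetween.exists_isBlockChain [Finite V] (h : H.NonseparableBetween x y) :
    ∃ m B, H.IsBlockChain x y m B := by
  induction hn : H.verts.ncard using Nat.strong_induction_on generalizing H x y with
  | _ n ih =>
  subst hn
  by_cases hH : H.Nonseparable
  · exact ⟨0, fun _ => H, fun _ _ => hH.isBlockOf_self,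
      fun _ _ => ⟨x, h.left_mem, y, h.right_mem, h.ne⟩, fun a ha => ⟨0, le_rfl, ha⟩,
      fun a b hab => ⟨0, le_rfl, hab⟩, h.left_mem, h.right_mem, by simp, by simp, by simp⟩
  obtain ⟨v, hv, hvx, hvy, hxy⟩ : ∃ v ∈ H.verts, x ≠ v ∧ y ≠ v ∧ ¬ H.ReachAvoiding {v} x y := by
    by_contra! hcon
    refine hH ⟨⟨x, h.left_mem⟩, fun S hS u hu w hw huS hwS => ?_⟩
    by_cases hSH : ∃ v ∈ S, v ∈ H.verts
    · obtain ⟨v, hvS, hv⟩ := hSH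
      obtain rfl : S = {v} := hS.eq_singleton_of_mem hvS
      have hu' := h.reach_or v u hu huS
      have hw' := h.reach_or v w hw hwS
      have hne : ∀ {a b}, a ∉ ({v} : Set V) → H.ReachAvoiding {v} a b → b ≠ v := by
        rintro a b ha hab rfl
        rcases hab.eq_or_notMem with rfl | h
        exacts [ha rfl, h rfl]
      have hxy' : x ≠ v → y ≠ v → H.ReachAvoiding {v} x y := hcon v hv
      rcases hu' with hu' | hu' <;> rcases hw' with hw' | hw'
      · exact hu'.trans hw'.symm
      · exact hu'.trans ((hxy' (hne huS hu') (hne hwS hw')).trans hw'.symm)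
      · exact hu'.trans ((hxy' (hne hwS hw') (hne huS hu')).symm.trans hw'.symm)
      · exact hu'.trans hw'.symm
    · exact (h.reach u hu w hw).mono le_rfl fun a ha _ haS => hSH ⟨a, haS, ha⟩
  have hyx : ¬ H.ReachAvoiding {v} y x := fun h => hxy h.symm
  have hx1 : x ∉ (H.side v y).verts := by
    rintro (h | h)
    exacts [hyx h, hvx h]
  have hy1 : y ∉ (H.side v x).verts := by
    rintro (h | h)
    exacts [hxy h, hvy h]
  have hle1 := side_le h.left_mem hv
  have hle2 := side_le h.right_mem hv
  have hinter : ∀ a ∈ (H.side v x).verts, a ∈ (H.side v y).verts → a = v := by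
    rintro a (ha | ha) (ha' | ha')
    · exact absurd (ha.trans ha'.symm) hxy
    · exact ha'
    · exact ha
    · exact ha
  have hcover : ∀ a ∈ H.verts, a ≠ v →
      H.ReachAvoiding {v} x a ∨ H.ReachAvoiding {v} y a := fun a ha hav =>
    (h.reach_or v a ha hav).imp ReachAvoiding.symm ReachAvoiding.symm
  have hadj : ∀ a b, H.Adj a b → (H.side v x).Adj a b ∨ (H.side v y).Adj a b := by
    have key : ∀ a b, a ≠ v → H.Adj a b → (H.side v x).Adj a b ∨ (H.side v y).Adj a b :=
      fun a b hav hab => (hcover a hab.fst_mem hav).imp (side_adj hvx · hab) (side_adj hvy · hab)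
    intro a b hab
    by_cases hav : a = v
    · have hbv : b ≠ v := fun h => hab.ne (hav.trans h.symm)
      exact (key b a hbv hab.symm).imp Subgraph.Adj.symm Subgraph.Adj.symm
    · exact key a b hav hab
  obtain ⟨m, B, hB⟩ := ih _ (Set.ncard_lt_ncard ⟨hle1.1, fun h' => hy1 (h' h.right_mem)⟩)
    (h.side hv hvx hvy hxy) rfl
  obtain ⟨k, C, hC⟩ := ih _ (Set.ncard_lt_ncard ⟨hle2.1, fun h' => hx1 (h' h.left_mem)⟩)
    (h.symm.side hv hvy hvx hyx).symm rfl
  have hD1 : ∀ i ≤ m, (if i ≤ m then B i else C (i - m - 1)) = B i := fun i hi => if_pos hi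
  have hD2 : ∀ i, (if m + 1 + i ≤ m then B (m + 1 + i) else C (m + 1 + i - m - 1)) = C i :=
    fun i => by rw [if_neg (by omega)]; congr; omega
  have hBle : ∀ i ≤ m, (B i).verts ⊆ (H.side v x).verts := fun i hi => (hB.isBlockOf i hi).1.1
  have hCle : ∀ i ≤ k, (C i).verts ⊆ (H.side v y).verts := fun i hi => (hC.isBlockOf i hi).1.1
  have split : ∀ (p : ℕ → G.Subgraph → Prop), (∀ i ≤ m, p i (B i)) →
      (∀ i ≤ k, p (m + 1 + i) (C i)) →
      ∀ i ≤ m + 1 + k, p i (if i ≤ m then B i else C (i - m - 1)) := by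
    intro p h1 h2 i hi
    by_cases him : i ≤ m
    · rw [if_pos him]
      exact h1 i him
    · obtain ⟨j, rfl⟩ := Nat.exists_eq_add_of_lt (not_le.mp him)
      rw [if_neg him]
      have := h2 j (by omega)
      rwa [show m + j + 1 - m - 1 = j by omega, show m + j + 1 = m + 1 + j by omega]
  refine ⟨m + 1 + k, fun i => if i ≤ m then B i else C (i - m - 1), ?_, ?_, ?_, ?_, ?_, ?_, ?_,
    ?_, ?_⟩
  · exact split (fun _ D => IsBlockOf G D H)
      (fun i hi => isBlockOf_of_side h.left_mem hv (hB.isBlockOf i hi) (hB.nontrivial i hi))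
      (fun i hi => isBlockOf_of_side h.right_mem hv (hC.isBlockOf i hi) (hC.nontrivial i hi))
  · exact split (fun _ D => D.verts.Nontrivial) hB.nontrivial hC.nontrivial
  · intro a ha
    have : a ∈ (H.side v x).verts ∨ a ∈ (H.side v y).verts := by
      by_cases hav : a = v
      · exact .inl (.inr hav)
      · exact (hcover a ha hav).imp .inl .inl
    rcases this with h | h
    · obtain ⟨i, hi, ha⟩ := hB.verts_subset a h
      exact ⟨i, by omega, by rwa [hD1 i hi]⟩
    · obtain ⟨i, hi, ha⟩ := hC.verts_subset a h
      exact ⟨m + 1 + i, by omega, by rwa [hD2 i]⟩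
  · intro a b hab
    rcases hadj a b hab with h | h
    · obtain ⟨i, hi, ha⟩ := hB.adj_subset a b h
      exact ⟨i, by omega, by rwa [hD1 i hi]⟩
    · obtain ⟨i, hi, ha⟩ := hC.adj_subset a b h
      exact ⟨m + 1 + i, by omega, by rwa [hD2 i]⟩
  · simpa using hB.left_mem
  · rw [hD2]
    exact hC.right_mem
  · intro i hi
    rcases lt_trichotomy i m with him | rfl | him
    · rw [hD1 i him.le, hD1 (i + 1) him]
      exact hB.inter i him
    · refine ⟨v, ?_⟩
      rw [hD1 i le_rfl, hD2 0]
      refine subset_antisymm (fun a ha => ?_) ?_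
      · exact hinter a (hBle i le_rfl ha.1) (hCle 0 (by omega) ha.2)
      · rintro _ rfl
        exact ⟨hB.right_mem, hC.left_mem⟩
    · obtain ⟨j, rfl⟩ := Nat.exists_eq_add_of_lt him
      have h1 := hD2 j
      have h2 := hD2 (j + 1)
      rw [show m + 1 + j = m + j + 1 by omega] at h1
      rw [show m + 1 + (j + 1) = m + j + 1 + 1 by omega] at h2
      rw [h1, h2]
      exact hC.inter j (by omega)
  · exact split (fun i D => x ∈ D.verts → i = 0) hB.left_unique
      fun i hi hx => absurd (hCle i hi hx) hx1
  · exact split (fun i D => y ∈ D.verts → i = m + 1 + k)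
      (fun i hi hy => absurd (hBle i hi hy) hy1)
      (fun i hi hy => by rw [hC.right_unique i hi hy])

end SimpleGraph.Subgraph

section RemoveInt

variable {V : Type*} {G : SimpleGraph V} {x y : V} {P : G.Walk x y}

theorem mem_verts_removeInt {w : V} : w ∈ (removeInt P).verts ↔ w ∉ innSet P := by
  simp [removeInt]

theorem removeInt_adj {a b : V} : (removeInt P).Adj a b ↔
    G.Adj a b ∧ a ∉ innSet P ∧ b ∉ innSet P ∧ (P.length = 1 → s(a, b) ∉ P.edges) := by
  by_cases h : P.length = 1 <;> simp [removeInt, h] <;> tauto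

theorem left_mem_removeInt : x ∈ (removeInt P).verts :=
  mem_verts_removeInt.mpr fun h => h.2.1 rfl

theorem right_mem_removeInt : y ∈ (removeInt P).verts :=
  mem_verts_removeInt.mpr fun h => h.2.2 rfl

theorem eq_or_eq_of_mem_support_of_mem_removeInt {t : V} (ht : t ∈ P.support)
    (htH : t ∈ (removeInt P).verts) : t = x ∨ t = y := by
  by_contra! h
  exact mem_verts_removeInt.mp htH ⟨ht, h⟩

/-- An edge of `G` at a vertex of `G − Int P` that is not in `G − Int P` is an edge of `P`. -/
theorem toSubgraph_adj_of_not_removeInt_adj [Fintype V] [DecidableRel G.Adj] (hP : P.IsPath)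
    (hinner : ∀ w ∈ innSet P, G.degree w = 2) {a b : V} (ha : a ∈ (removeInt P).verts)
    (hab : G.Adj a b) (h : ¬ (removeInt P).Adj a b) : P.toSubgraph.Adj a b := by
  rw [mem_verts_removeInt] at ha
  by_cases hb : b ∈ innSet P
  · obtain ⟨i, hi, hil⟩ := Walk.mem_support_iff_exists_getVert.mp hb.1
    have hi0 : i ≠ 0 := by
      rintro rfl
      exact hb.2.1 (by simpa using hi.symm)
    have hil' : i < P.length := by
      refine lt_of_le_of_ne hil ?_
      rintro rfl
      exact hb.2.2 (by simpa using hi.symm)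
    have h2 := hP.ncard_neighborSet_toSubgraph_internal_eq_two hi0 hil'
    rw [hi] at h2
    have heq : P.toSubgraph.neighborSet b = G.neighborSet b := by
      refine Set.eq_of_subset_of_ncard_le (P.toSubgraph.neighborSet_subset b) ?_ (Set.toFinite _)
      rw [h2, ← coe_neighborFinset, Set.ncard_coe_finset, card_neighborFinset_eq_degree,
        hinner b hb]
    have : a ∈ P.toSubgraph.neighborSet b := heq ▸ hab.symm
    exact this.symm
  · rw [removeInt_adj] at h
    push Not at h
    exact Walk.adj_toSubgraph_iff_mem_edges.mpr (h hab ha hb).2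

theorem TwoConn.exists_reflTransGen (h2 : TwoConn G) {u v w : V} (hu : u ≠ v) (hw : w ≠ v) :
    Relation.ReflTransGen (fun a b => G.Adj a b ∧ a ≠ v ∧ b ≠ v) u w :=
  Relation.ReflTransGen.lift (fun a : ({v}ᶜ : Set V) => a.1) (fun a b h => ⟨h, a.2, b.2⟩) _ _
    ((reachable_iff_reflTransGen _ _).mp (h2.2.2 v ⟨u, hu⟩ ⟨w, hw⟩))

theorem exists_removeInt_adj_pair [Fintype V] [DecidableRel G.Adj] {u c : V}
    (hd : 3 ≤ G.degree u) (hu : ∀ z, G.Adj u z → ¬ (removeInt P).Adj u z → z = c) :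
    ∃ z₁ z₂, z₁ ≠ z₂ ∧ (removeInt P).Adj u z₁ ∧ (removeInt P).Adj u z₂ := by
  classical
  have : 1 < ((G.neighborFinset u).erase c).card := by
    have := Finset.pred_card_le_card_erase (s := G.neighborFinset u) (a := c)
    rw [card_neighborFinset_eq_degree] at this
    omega
  obtain ⟨a, ha, b, hb, hab⟩ := Finset.one_lt_card.mp this
  simp only [Finset.mem_erase, mem_neighborFinset] at ha hb
  exact ⟨a, b, hab, not_not.mp fun h => ha.1 (hu a ha.2 h), not_not.mp fun h => hb.1 (hu b hb.2 h)⟩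

theorem nonseparableBetween_removeInt [Fintype V] [DecidableRel G.Adj] (h2 : TwoConn G)
    (hP : P.IsPath) (hxy : x ≠ y) (hinner : ∀ w ∈ innSet P, G.degree w = 2)
    (hx : ∃ z, (removeInt P).Adj x z) : (removeInt P).NonseparableBetween x y := by
  have key : ∀ S : Set V, S.Subsingleton → ∀ w ∈ (removeInt P).verts, w ∉ S →
      (removeInt P).ReachAvoiding S w x ∨ (removeInt P).ReachAvoiding S w y := by
    intro S hS w hw hwS
    obtain ⟨v, hv, hSv⟩ : ∃ v, w ≠ v ∧ ∀ t, t ≠ v → t ∉ S := by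
      rcases hS.eq_empty_or_singleton with rfl | ⟨v, rfl⟩
      · by_cases hwx : w = x
        · exact ⟨y, hwx ▸ hxy, by simp⟩
        · exact ⟨x, hwx, by simp⟩
      · exact ⟨v, hwS, by simp⟩
    have main : ∀ t, Relation.ReflTransGen (fun a b => G.Adj a b ∧ a ≠ v ∧ b ≠ v) w t →
        (t ∈ (removeInt P).verts ∧ (removeInt P).ReachAvoiding S w t) ∨
          ((removeInt P).ReachAvoiding S w x ∨ (removeInt P).ReachAvoiding S w y) := by
      intro t ht
      induction ht with
      | refl => exact .inl ⟨hw, .refl⟩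
      | @tail a b _ hab ih =>
        refine ih.elim (fun ⟨ha, hr⟩ => ?_) .inr
        by_cases h : (removeInt P).Adj a b
        · exact .inl ⟨h.snd_mem, .tail hr ⟨h, hSv a hab.2.1, hSv b hab.2.2⟩⟩
        · have hPa := toSubgraph_adj_of_not_removeInt_adj hP hinner ha hab.1 h
          rcases eq_or_eq_of_mem_support_of_mem_removeInt
            (P.mem_verts_toSubgraph.mp hPa.fst_mem) ha with rfl | rfl
          · exact .inr (.inl hr)
          · exact .inr (.inr hr)
    by_cases hxv : x = v
    · exact (main y (h2.exists_reflTransGen hv (hxv ▸ hxy.symm))).elim (fun h => .inr h.2) id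
    · exact (main x (h2.exists_reflTransGen hv hxv)).elim (fun h => .inl h.2) id
  obtain ⟨z, hz⟩ := hx
  have hzy : (removeInt P).ReachAvoiding {x} z y := by
    refine (key {x} Set.subsingleton_singleton z hz.snd_mem hz.ne.symm).resolve_left fun h => ?_
    exact h.eq_or_notMem.elim hz.ne.symm (· rfl)
  have hxy' : (removeInt P).ReachAvoiding ∅ x y :=
    .head ⟨hz, by simp⟩ (hzy.mono le_rfl fun _ _ _ h => h)
  have hx : ∀ w ∈ (removeInt P).verts, (removeInt P).ReachAvoiding ∅ w x := fun w hw =>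
    (key ∅ Set.subsingleton_empty w hw (by simp)).elim id (·.trans hxy'.symm)
  exact ⟨left_mem_removeInt, right_mem_removeInt, hxy,
    fun u hu w hw => (hx u hu).trans (hx w hw).symm,
    fun v w hw hwv => key {v} Set.subsingleton_singleton w hw hwv⟩

theorem not_removeInt_adj_of_toSubgraph_adj (hP : P.IsPath) {a b : V}
    (h : P.toSubgraph.Adj a b) : ¬ (removeInt P).Adj a b := by
  intro hab
  have he : s(a, b) ∈ P.edges := Walk.adj_toSubgraph_iff_mem_edges.mp h
  have hxy : s(x, y) ∈ P.edges := by
    have ha := eq_or_eq_of_mem_support_of_mem_removeInt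
      (P.mem_verts_toSubgraph.mp h.fst_mem) hab.fst_mem
    have hb := eq_or_eq_of_mem_support_of_mem_removeInt
      (P.mem_verts_toSubgraph.mp h.snd_mem) hab.snd_mem
    have hne := hab.ne
    rcases ha with rfl | rfl <;> rcases hb with rfl | rfl
    · exact absurd rfl hne
    · exact he
    · rwa [Sym2.eq_swap]
    · exact absurd rfl hne
  exact (removeInt_adj.mp hab).2.2.2 (hP.length_eq_one_of_mem_edges hxy) he

theorem SimpleGraph.Subgraph.ReachAvoiding.exists_walk {H : G.Subgraph} {u v w : V} (huv : u ≠ v)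
    (h : H.ReachAvoiding {v} u w) : ∃ p : H.spanningCoe.Walk u w, v ∉ p.support := by
  induction h with
  | refl => exact ⟨.nil, by simpa using huv.symm⟩
  | tail _ hab ih =>
    obtain ⟨p, hp⟩ := ih
    refine ⟨p.concat (show H.spanningCoe.Adj _ _ from hab.1), ?_⟩
    rw [Walk.support_concat]
    simpa [hp] using fun h => hab.2.2 h.symm

theorem not_nonseparable_removeInt {A : Set V} (hG : Multi4 G) (hbip : Bipartition G A)
    (hP : P.IsPath) (hlen : 1 ≤ P.length) (hxy : x ∈ A ↔ y ∉ A)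
    (hx : ∃ z₁ z₂, z₁ ≠ z₂ ∧ (removeInt P).Adj x z₁ ∧ (removeInt P).Adj x z₂) :
    ¬ (removeInt P).Nonseparable := by
  intro hns
  have hne : x ≠ y := by
    rintro rfl
    tauto
  obtain ⟨z₁, z₂, hz, h₁, h₂⟩ := hx
  have hle : (removeInt P).spanningCoe ≤ G := Subgraph.spanningCoe_le _
  obtain ⟨p, q, hp, hq, hpq, hd⟩ := Walk.exists_two_internally_disjoint
    (G := (removeInt P).spanningCoe) (U := (removeInt P).verts) (x := x) (y := y)
    (fun a b h => Subgraph.Adj.snd_mem h)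
    (fun v a ha b hb hav hbv =>
      (hns.2 {v} Set.subsingleton_singleton a ha b hb hav hbv).exists_walk hav)
    left_mem_removeInt
    (fun a => by
      by_cases h : z₁ = a
      · exact ⟨z₂, h₂.snd_mem, h₂.ne.symm, fun h' => hz (h.trans h'.symm)⟩
      · exact ⟨z₁, h₁.snd_mem, h₁.ne.symm, h⟩)
    hne
    (Relation.ReflTransGen.mono (fun _ _ h => h.1) _ _
      (hns.2 ∅ Set.subsingleton_empty x left_mem_removeInt y right_mem_removeInt (by simp)
        (by simp)))
  have hsupp : ∀ r : (removeInt P).spanningCoe.Walk x y, ∀ t ∈ r.support,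
      t ∈ (removeInt P).verts := by
    intro r t ht
    rcases Walk.mem_support_iff_exists_mem_edges.mp ht with h | ⟨e, he, hte⟩
    · rw [h]
      exact right_mem_removeInt
    · obtain ⟨s, rfl⟩ := hte
      exact Subgraph.Adj.fst_mem (r.adj_of_mem_edges he)
  have hcyc : ∀ r : (removeInt P).spanningCoe.Walk x y, r.IsPath → 4 ∣ P.length + r.length := by
    intro r hr
    have hPr : P ≠ r.mapLe hle := by
      intro h
      have hadj := P.toSubgraph_adj_snd (Walk.not_nil_iff_lt_length.mpr hlen)
      refine not_removeInt_adj_of_toSubgraph_adj hP hadj ?_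
      have := Walk.adj_toSubgraph_iff_mem_edges.mp hadj
      have he : s(x, P.snd) ∈ (r.mapLe hle).edges := h ▸ this
      rw [Walk.edges_mapLe_eq_edges] at he
      exact r.adj_of_mem_edges he
    have := hG _ (hP.isCycle_append_reverse (hr.mapLe hle) hPr fun t ht htr =>
      eq_or_eq_of_mem_support_of_mem_removeInt ht
        (hsupp r t (by rwa [Walk.support_mapLe_eq_support] at htr)))
    simpa using this
  have h1 := hcyc p hp
  have h2 := hcyc q hq
  have h3 := hG _ ((hp.isCycle_append_reverse hq hpq hd).mapLe hle)
  have hodd : ¬ Even P.length := by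
    rw [P.even_length_iff_of_bipartition hbip]
    tauto
  simp only [Walk.length_mapLe, Walk.length_append, Walk.length_reverse] at h3
  rw [Nat.even_iff] at hodd
  omega

theorem SimpleGraph.Subgraph.Nonseparable.twoConn {B : G.Subgraph} (hB : B.Nonseparable) {u a b : V}
    (hab : a ≠ b) (ha : B.Adj u a) (hb : B.Adj u b) : TwoConn B.coe :=
  have h := (Subgraph.connected_and_noCutVertex_iff B).mpr hB
  ⟨h.1, ⟨⟨u, ha.fst_mem⟩, ⟨a, ha.snd_mem⟩, ⟨b, hb.snd_mem⟩, by simpa using ha.ne,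
    by simpa using hb.ne, by simpa using hab⟩, h.2⟩

end RemoveInt

/-- Lemma 2.2.  Block-path structure of `G − Int P` for a path `P`
whose inner vertices have degree 2 and whose endpoints are of different types and have
degree at least 3. -/
theorem block_chain_of_removeInt {V : Type*} [Fintype V] [DecidableEq V]
    (G : SimpleGraph V) [DecidableRel G.Adj] (A : Set V)
    (hG : Multi4 G) (hbip : Bipartition G A) (h2 : TwoConn G)
    {x y : V} (P : G.Walk x y) (hP : P.IsPath) (hlen : 1 ≤ P.length)
    (hinner : ∀ w ∈ innSet P, G.degree w = 2)
    (hxy : x ∈ A ↔ y ∉ A) (hdx : 3 ≤ G.degree x) (hdy : 3 ≤ G.degree y) :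
    ∃ (m : ℕ) (B : Fin (m + 2) → G.Subgraph) (a : Fin (m + 1) → V),
      (∀ i, IsBlockOf G (B i) (removeInt P)) ∧
      (⨆ i, B i) = removeInt P ∧
      TwoConn (B 0).coe ∧ TwoConn (B (Fin.last (m + 1))).coe ∧
      x ∈ (B 0).verts ∧ y ∈ (B (Fin.last (m + 1))).verts ∧
      (∀ i : Fin (m + 1), (B i.castSucc).verts ∩ (B i.succ).verts = {a i}) ∧
      a 0 ≠ x ∧ a (Fin.last m) ≠ y := by
  have hne : x ≠ y := by
    rintro rfl
    tauto
  have hnil : ¬ P.Nil := Walk.not_nil_iff_lt_length.mpr hlen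
  have hx2 := exists_removeInt_adj_pair (P := P) (c := P.snd) hdx fun z hz hnz =>
    (hP.neighborSet_toSubgraph_startpoint hnil).le
      (toSubgraph_adj_of_not_removeInt_adj hP hinner left_mem_removeInt hz hnz)
  have hy2 := exists_removeInt_adj_pair (P := P) (c := P.penultimate) hdy fun z hz hnz =>
    (hP.neighborSet_toSubgraph_endpoint hnil).le
      (toSubgraph_adj_of_not_removeInt_adj hP hinner right_mem_removeInt hz hnz)
  have hns := not_nonseparable_removeInt hG hbip hP hlen hxy hx2
  obtain ⟨z₁, z₂, hz, hz₁, hz₂⟩ := hx2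
  obtain ⟨w₁, w₂, hw, hw₁, hw₂⟩ := hy2
  obtain ⟨n, B, hB⟩ := (nonseparableBetween_removeInt h2 hP hne hinner ⟨z₁, hz₁⟩).exists_isBlockChain
  have hblock : ∀ i ≤ n, (B i).Nonseparable := fun i hi =>
    (Subgraph.isBlockOf_iff.mp (hB.isBlockOf i hi)).2.1
  have hle : ∀ i ≤ n, B i ≤ removeInt P := fun i hi => (hB.isBlockOf i hi).1
  obtain ⟨m, rfl⟩ : ∃ m, n = m + 1 := by
    refine Nat.exists_eq_succ_of_ne_zero ?_
    rintro rfl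
    have : removeInt P = B 0 := by
      refine le_antisymm (show _ ∧ _ from ⟨fun a ha => ?_, fun a b hab => ?_⟩) (hle 0 le_rfl)
      · obtain ⟨i, hi, h⟩ := hB.verts_subset a ha
        rwa [Nat.le_zero.mp hi] at h
      · obtain ⟨i, hi, h⟩ := hB.adj_subset a b hab
        rwa [Nat.le_zero.mp hi] at h
    exact hns (this ▸ hblock 0 le_rfl)
  have hleft : ∀ z, (removeInt P).Adj x z → (B 0).Adj x z := fun z hz => by
    obtain ⟨i, hi, h⟩ := hB.adj_subset x z hz
    rwa [hB.left_unique i hi h.fst_mem] at h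
  have hright : ∀ z, (removeInt P).Adj y z → (B (m + 1)).Adj y z := fun z hz => by
    obtain ⟨i, hi, h⟩ := hB.adj_subset y z hz
    rwa [hB.right_unique i hi h.fst_mem] at h
  choose a ha using fun i : Fin (m + 1) => hB.inter i i.2
  refine ⟨m, fun i => B i, a, fun i => hB.isBlockOf i (by omega), ?_, ?_, ?_, ?_, ?_, ?_, ?_, ?_⟩
  · refine le_antisymm (iSup_le fun i => hle i (by omega)) ⟨fun v hv => ?_, fun u v huv => ?_⟩
    · obtain ⟨i, hi, h⟩ := hB.verts_subset v hv
      rw [Subgraph.verts_iSup]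
      exact Set.mem_iUnion.mpr ⟨⟨i, by omega⟩, h⟩
    · obtain ⟨i, hi, h⟩ := hB.adj_subset u v huv
      exact Subgraph.iSup_adj.mpr ⟨⟨i, by omega⟩, h⟩
  · exact (hblock 0 (by omega)).twoConn hz (hleft z₁ hz₁) (hleft z₂ hz₂)
  · exact (hblock (m + 1) le_rfl).twoConn hw (hright w₁ hw₁) (hright w₂ hw₂)
  · exact hB.left_mem
  · exact hB.right_mem
  · exact ha
  · intro h
    have h' : a 0 ∈ (B 0).verts ∩ (B 1).verts := (ha 0).ge rfl
    have := hB.left_unique 1 (by omega) (h ▸ h'.2)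
    omega
  · intro h
    have h' : a (Fin.last m) ∈ (B m).verts ∩ (B (m + 1)).verts := (ha (Fin.last m)).ge rfl
    have := hB.right_unique m (by omega) (h ▸ h'.1)
    omega
end

section
/- Let G be a 2-connected simple graph in which every cycle has length divisible by 4, with vertex bipartition {V_α, V_β}. Then no 4-cycle of G contains two adjacent vertices that both have degree at least 3 in G; equivalently, every edge of a 4-cycle in G has at least one endpoint of degree 2 in G. -/
open SimpleGraph

/-- In a multi-4-cycles graph, two disjoint paths joined at both ends by an edge close up to a
cycle, so their lengths add up to `2` modulo `4`. -/
lemma Multi4.four_dvd_of_disjoint_paths {V : Type*} {G : SimpleGraph V} (hG : Multi4 G)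
    {a b c d : V} {p : G.Walk a b} {q : G.Walk c d} (hp : p.IsPath) (hq : q.IsPath)
    (hpq : ∀ v ∈ p.support, v ∉ q.support) (hbc : G.Adj b c) (hda : G.Adj d a)
    (hlen : 1 ≤ p.length + q.length) : 4 ∣ p.length + q.length + 2 := by
  have hr : (p.append (q.cons hbc)).IsPath := by
    rw [Walk.isPath_def, Walk.support_append, List.nodup_append]
    simp only [Walk.support_cons, List.tail_cons]
    exact ⟨hp.support_nodup, hq.support_nodup, fun v hv w hw h => hpq v hv (h ▸ hw)⟩
  have hcyc : ((p.append (q.cons hbc)).cons hda).IsCycle := by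
    refine Walk.cons_isCycle_iff _ _ |>.2 ⟨hr, fun he => ?_⟩
    have h1 := hr.length_eq_one_of_mem_edges (Sym2.eq_swap ▸ he)
    simp at h1
    omega
  have h4 := hG _ hcyc
  simp only [Walk.length_cons, Walk.length_append] at h4
  convert h4 using 1
  omega

/-- A walk that enters `S` can be cut just before it does so for the first time. -/
lemma exists_walk_avoiding_until {V : Type*} {G : SimpleGraph V} (S : Set V) {u c : V}
    (q : G.Walk u c) (hu : u ∉ S) (hc : c ∈ S) :
    ∃ b ∈ q.support, b ∈ S ∧ ∃ b', G.Adj b' b ∧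
      ∃ p : G.Walk u b', ∀ v ∈ p.support, v ∉ S := by
  induction q with
  | nil => exact absurd hc hu
  | @cons u v c h q ih =>
    by_cases hv : v ∈ S
    · exact ⟨v, by simp, hv, u, h, Walk.nil, by simpa using hu⟩
    · obtain ⟨b, hb, hbS, b', hb', p, hp⟩ := ih hv hc
      refine ⟨b, by simp [hb], hbS, b', hb', p.cons h, ?_⟩
      simpa [hu] using hp

/-- In a 2-connected graph, an edge leaving `S` at `a` extends to an ear of `S` ending at a vertex
other than `a`. -/
lemma TwoConn.exists_ear {V : Type*} {G : SimpleGraph V} (h2 : TwoConn G) (S : Set V)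
    {a a' c : V} (ha : a ∈ S) (ha' : a' ∉ S) (hc : c ∈ S) (hca : c ≠ a) :
    ∃ b ∈ S, b ≠ a ∧ ∃ b', G.Adj b' b ∧ ∃ p : G.Walk a' b', ∀ v ∈ p.support, v ∉ S := by
  have haa' : a' ≠ a := fun h => ha' (h ▸ ha)
  obtain ⟨q⟩ := h2.2.2 a ⟨a', haa'⟩ ⟨c, hca⟩
  obtain ⟨b, hb, hbS, h⟩ :=
    exists_walk_avoiding_until S (q.map (Embedding.induce ({a}ᶜ : Set V)).toHom) ha' hc
  refine ⟨b, hbS, ?_, h⟩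
  rw [Walk.support_map, List.mem_map] at hb
  obtain ⟨v, -, rfl⟩ := hb
  exact v.2

/-- In a multi-4-cycles graph, no ear of a 4-cycle joins two adjacent vertices of the cycle. -/
lemma Multi4.not_ear_of_adj {V : Type*} {G : SimpleGraph V} (hG : Multi4 G) {a b c d : V}
    (hab : G.Adj a b) (hbc : G.Adj b c) (hcd : G.Adj c d) (hda : G.Adj d a)
    (hac : a ≠ c) (hbd : b ≠ d) {a' b' : V} (ha : G.Adj a a') (hb : G.Adj b' b)
    (p : G.Walk a' b') (hp : ∀ v ∈ p.support, v ∉ ({a, b, c, d} : Set V)) : False := by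
  classical
  have hp' : ∀ v ∈ p.bypass.support, v ∉ ({a, b, c, d} : Set V) :=
    fun v hv => hp v (p.support_bypass_subset_support hv)
  simp only [Set.mem_insert_iff, Set.mem_singleton_iff, not_or] at hp'
  have h1 := hG.four_dvd_of_disjoint_paths p.bypass_isPath
    (q := Walk.cons hab.symm .nil) (by simp [hab.ne'])
    (fun v hv => by simp [hp' v hv]) hb ha (by simp)
  have h2 := hG.four_dvd_of_disjoint_paths p.bypass_isPath
    (q := .cons hbc (.cons hcd (.cons hda .nil)))
    (by simp [hab.ne', hbc.ne, hcd.ne, hda.ne, hac.symm, hbd])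
    (fun v hv => by simp [hp' v hv]) hb ha (by simp)
  simp only [Walk.length_cons, Walk.length_nil] at h1 h2
  omega

/-- A vertex with two given distinct neighbours and degree other than `2` has a third neighbour. -/
lemma exists_third_neighbor {V : Type*} [Fintype V] [DecidableEq V] {G : SimpleGraph V}
    [DecidableRel G.Adj] {x y w : V} (hy : G.Adj x y) (hw : G.Adj x w) (hyw : y ≠ w)
    (hd : G.degree x ≠ 2) : ∃ v, G.Adj x v ∧ v ≠ y ∧ v ≠ w := by
  by_contra! h
  apply hd
  have : G.neighborFinset x = {y, w} := by
    ext v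
    simp only [mem_neighborFinset, Finset.mem_insert, Finset.mem_singleton]
    constructor
    · intro hv
      by_contra! h'
      exact h'.2 (h v hv h'.1)
    · rintro (rfl | rfl) <;> assumption
  rw [← card_neighborFinset_eq_degree, this, Finset.card_pair hyw]

/-- Two adjacent vertices of a 4-cycle cannot both have degree other than `2`: each would be an end of
an ear to the opposite vertex, and two such ears together give a cycle of length `2` modulo `4`. -/
lemma Multi4.degree_eq_two_or_of_four_cycle {V : Type*} [Fintype V] [DecidableEq V]
    {G : SimpleGraph V} [DecidableRel G.Adj] {A : Set V} (hG : Multi4 G)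
    (hbip : Bipartition G A) (h2 : TwoConn G) {x y z w : V}
    (hxy : G.Adj x y) (hyz : G.Adj y z) (hzw : G.Adj z w) (hwx : G.Adj w x)
    (hxz : x ≠ z) (hyw : y ≠ w) : G.degree x = 2 ∨ G.degree y = 2 := by
  by_contra! hd
  obtain ⟨x', hx', hx'y, hx'w⟩ := exists_third_neighbor hxy hwx.symm hyw hd.1
  obtain ⟨y', hy', hy'x, hy'z⟩ := exists_third_neighbor hxy.symm hyz hxz hd.2
  have hx'z : x' ≠ z := by
    rintro rfl
    have := hbip hx'
    have := hbip hyz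
    have := hbip hxy
    tauto
  have hy'w : y' ≠ w := by
    rintro rfl
    have := hbip hy'
    have := hbip hwx
    have := hbip hxy
    tauto
  set S : Set V := {x, y, z, w} with hS
  have hx'S : x' ∉ S := by simp [hS, hx'.ne', hx'y, hx'z, hx'w]
  have hy'S : y' ∉ S := by simp [hS, hy'.ne', hy'x, hy'z, hy'w]
  obtain ⟨b, hbS, hbx, z', hz', p, hp⟩ :=
    h2.exists_ear S (a := x) (c := y) (by simp [hS]) hx'S (by simp [hS]) hxy.ne'
  obtain ⟨e, heS, hey, w', hw', q, hq⟩ :=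
    h2.exists_ear S (a := y) (c := x) (by simp [hS]) hy'S (by simp [hS]) hxy.ne
  have hS₁ : ∀ v, v ∉ S → v ∉ ({x, w, z, y} : Set V) := by
    intro v; simp only [hS, Set.mem_insert_iff, Set.mem_singleton_iff]; tauto
  have hS₂ : ∀ v, v ∉ S → v ∉ ({y, x, w, z} : Set V) := by
    intro v; simp only [hS, Set.mem_insert_iff, Set.mem_singleton_iff]; tauto
  have hS₃ : ∀ v, v ∉ S → v ∉ ({y, z, w, x} : Set V) := by
    intro v; simp only [hS, Set.mem_insert_iff, Set.mem_singleton_iff]; tauto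
  have hbz : b = z := by
    rcases hbS with rfl | rfl | rfl | rfl
    · exact absurd rfl hbx
    · exact (hG.not_ear_of_adj hxy hyz hzw hwx hxz hyw hx' hz' p hp).elim
    · rfl
    · exact (hG.not_ear_of_adj hwx.symm hzw.symm hyz.symm hxy.symm hxz hyw.symm hx' hz' p
        fun v hv => hS₁ v (hp v hv)).elim
  have hew : e = w := by
    rcases heS with rfl | rfl | rfl | rfl
    · exact (hG.not_ear_of_adj hxy.symm hwx.symm hzw.symm hyz.symm hyw hxz hy' hw' q
        fun v hv => hS₂ v (hq v hv)).elim
    · exact absurd rfl hey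
    · exact (hG.not_ear_of_adj hyz hzw hwx hxy hyw hxz.symm hy' hw' q
        fun v hv => hS₃ v (hq v hv)).elim
    · rfl
  subst b e
  have hp' : ∀ v ∈ p.bypass.support, v ∉ S := fun v hv => hp v (p.support_bypass_subset_support hv)
  have hq' : ∀ v ∈ q.bypass.support, v ∉ S := fun v hv => hq v (q.support_bypass_subset_support hv)
  have hpq : ∀ v ∈ p.bypass.support, v ∉ q.bypass.support := by
    intro v hv hv'
    refine hG.not_ear_of_adj hxy hyz hzw hwx hxz hyw hx' hy'.symm
      ((p.bypass.takeUntil v hv).append (q.bypass.takeUntil v hv').reverse) fun t ht => ?_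
    rw [Walk.mem_support_append_iff, Walk.support_reverse, List.mem_reverse] at ht
    rcases ht with ht | ht
    · exact hp' t (Walk.support_takeUntil_subset_support _ _ ht)
    · exact hq' t (Walk.support_takeUntil_subset_support _ _ ht)
  simp only [hS, Set.mem_insert_iff, Set.mem_singleton_iff, not_or] at hp' hq'
  have hP := hG.four_dvd_of_disjoint_paths p.bypass_isPath
    (q := .cons hzw (.cons hwx .nil)) (by simp [hzw.ne, hwx.ne, hxz.symm])
    (fun v hv => by simp [hp' v hv]) hz' hx' (by simp)
  have hQ := hG.four_dvd_of_disjoint_paths q.bypass_isPath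
    (q := .cons hwx (.cons hxy .nil)) (by simp [hxy.ne, hwx.ne, hyw.symm])
    (fun v hv => by simp [hq' v hv]) hw' hy' (by simp)
  have hzy : (Walk.cons hyz.symm (.cons hy' q.bypass)).IsPath := by
    rw [Walk.cons_isPath_iff, Walk.cons_isPath_iff, Walk.support_cons, List.mem_cons, not_or]
    exact ⟨⟨q.bypass_isPath, fun h => (hq' y h).2.1 rfl⟩, hyz.ne', fun h => (hq' z h).2.2.1 rfl⟩
  have hpzy : (p.bypass.append (.cons hz' (.cons hyz.symm (.cons hy' q.bypass)))).IsPath := by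
    rw [Walk.isPath_def, Walk.support_append, List.nodup_append]
    refine ⟨p.bypass_isPath.support_nodup, hzy.support_nodup, ?_⟩
    rintro v hv t ht rfl
    simp only [Walk.support_cons, List.tail_cons, List.mem_cons] at ht
    rcases ht with rfl | rfl | ht
    · exact (hp' v hv).2.2.1 rfl
    · exact (hp' v hv).2.1 rfl
    · exact hpq v hv ht
  have hPQ := hG.four_dvd_of_disjoint_paths hpzy
    (q := .cons hwx .nil) (by simp [hwx.ne])
    (by
      intro v hv ht
      simp only [Walk.mem_support_append_iff, Walk.support_cons, Walk.support_nil, List.mem_cons,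
        List.not_mem_nil, or_false] at hv ht
      have := hp' v
      have := hq' v
      have := hp' z' (Walk.end_mem_support _)
      have := hzw.ne
      have := hxy.ne
      grind) hw' hx' (by simp)
  simp only [Walk.length_append, Walk.length_cons, Walk.length_nil] at hP hQ hPQ
  omega

/-- Lemma 2.3.  In a 2-connected graph with multi-4-cycles with a
bipartition, every edge of a 4-cycle has at least one endpoint of degree 2; i.e. no
4-cycle contains two adjacent vertices both of degree at least 3. -/
theorem four_cycle_edge_endpoint_degree_two {V : Type*} [Fintype V] [DecidableEq V]
    (G : SimpleGraph V) [DecidableRel G.Adj] (A : Set V)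
    (hG : Multi4 G) (hbip : Bipartition G A) (h2 : TwoConn G)
    {u : V} (c : G.Walk u u) (hc : c.IsCycle) (h4 : c.length = 4) :
    ∀ x y : V, s(x, y) ∈ c.edges → G.degree x = 2 ∨ G.degree y = 2 := by
  rcases c with _ | ⟨h₁, _ | ⟨h₂, _ | ⟨h₃, _ | ⟨h₄, _ | ⟨h₅, c⟩⟩⟩⟩⟩ <;>
    simp only [Walk.length_cons, Walk.length_nil] at h4 <;> try omega
  rename_i a b d
  have hub : u ≠ b := by
    have := hc.support_nodup
    simp only [Walk.support_cons, Walk.support_nil, List.tail_cons] at this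
    grind
  have had : a ≠ d := by
    have := hc.support_nodup
    simp only [Walk.support_cons, Walk.support_nil, List.tail_cons] at this
    grind
  have key : ∀ {x y z w : V}, G.Adj x y → G.Adj y z → G.Adj z w → G.Adj w x → x ≠ z → y ≠ w →
      ∀ {x' y' : V}, s(x', y') = s(x, y) → G.degree x' = 2 ∨ G.degree y' = 2 := by
    intro x y z w hxy hyz hzw hwx hxz hyw x' y' he
    have := hG.degree_eq_two_or_of_four_cycle hbip h2 hxy hyz hzw hwx hxz hyw
    rcases Sym2.eq_iff.1 he with ⟨rfl, rfl⟩ | ⟨rfl, rfl⟩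
    · exact this
    · exact this.symm
  intro x y he
  simp only [Walk.edges_cons, Walk.edges_nil, List.mem_cons, List.not_mem_nil, or_false] at he
  rcases he with he | he | he | he
  · exact key h₁ h₂ h₃ h₄ hub had he
  · exact key h₂ h₃ h₄ h₁ had hub.symm he
  · exact key h₃ h₄ h₁ h₂ hub.symm had.symm he
  · exact key h₄ h₁ h₂ h₃ had.symm hub he
end

section
/- Let G be a 2-connected simple graph in which every cycle has length divisible by 4, with vertex bipartition {V_α, V_β}. Let P be a path in G all of whose inner vertices have degree 2 in G and whose two endpoints are of different types and both have degree at least 3 in G. Then for every 2-connected block B of G − Int P there exists a path Q in G such that the pair (P, Q) cuts G and B is contained in one of the two components of G − (Int P ∪ Int Q). -/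
open SimpleGraph

/-- The graph `G − (Int P ∪ Int Q)`: inner vertices of paths of length ≥ 2 are
deleted; for a path of length 1 its edge is deleted. -/
def removeInt2 {V : Type*} {G : SimpleGraph V} {x₁ y₁ x₂ y₂ : V}
    (P : G.Walk x₁ y₁) (Q : G.Walk x₂ y₂) : G.Subgraph :=
  ((⊤ : G.Subgraph).deleteVerts (innSet P ∪ innSet Q)).deleteEdges
    ((if P.length = 1 then {e | e ∈ P.edges} else (∅ : Set (Sym2 V))) ∪
      (if Q.length = 1 then {e | e ∈ Q.edges} else (∅ : Set (Sym2 V))))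

/-- The pair `(P, Q)` of disjoint paths *cuts* `G` (with respect to the bipartition
`{A, Aᶜ}`): each path has all inner vertices of degree 2 in `G` and endpoints of
different types of degree at least 3 in `G` (here `P` runs from its type-α endpoint
`x₁` to its type-β endpoint `y₁`, and similarly for `Q`), and
`G − (Int P ∪ Int Q)` has exactly two components, one containing both type-α
endpoints `x₁, x₂` and the other containing both type-β endpoints `y₁, y₂`. -/
def Cuts {V : Type*} [Fintype V] [DecidableEq V] (G : SimpleGraph V)
    [DecidableRel G.Adj] (A : Set V) {x₁ y₁ x₂ y₂ : V}
    (P : G.Walk x₁ y₁) (Q : G.Walk x₂ y₂) : Prop :=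
  P.IsPath ∧ Q.IsPath ∧ 1 ≤ P.length ∧ 1 ≤ Q.length ∧
  (∀ w ∈ P.support, w ∉ Q.support) ∧
  x₁ ∈ A ∧ y₁ ∉ A ∧ x₂ ∈ A ∧ y₂ ∉ A ∧
  3 ≤ G.degree x₁ ∧ 3 ≤ G.degree y₁ ∧ 3 ≤ G.degree x₂ ∧ 3 ≤ G.degree y₂ ∧
  (∀ w ∈ innSet P, G.degree w = 2) ∧ (∀ w ∈ innSet Q, G.degree w = 2) ∧
  (removeInt2 P Q).spanningCoe.Reachable x₁ x₂ ∧
  (removeInt2 P Q).spanningCoe.Reachable y₁ y₂ ∧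
  ¬ (removeInt2 P Q).spanningCoe.Reachable x₁ y₁ ∧
  (∀ w ∈ (removeInt2 P Q).verts,
    (removeInt2 P Q).spanningCoe.Reachable x₁ w ∨ (removeInt2 P Q).spanningCoe.Reachable y₁ w)

namespace CutPartner

variable {V : Type*} {G H : SimpleGraph V} {v : ℕ → V} {n : ℕ}

/-- A trail and its bypass have the same length modulo `4` in a graph with multi-4-cycles. -/
lemma exists_isPath_of_isTrail [DecidableEq V] (hG : Multi4 G) {a b : V} (p : G.Walk a b)
    (hp : p.IsTrail) :
    ∃ q : G.Walk a b, q.IsPath ∧ q.edges ⊆ p.edges ∧ (4 : ℤ) ∣ (p.length : ℤ) - q.length := by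
  induction p with
  | nil => exact ⟨.nil, by simp, by simp, by simp⟩
  | @cons a c b h p ih =>
    rw [Walk.isTrail_cons] at hp
    obtain ⟨q, hq, hqp, hd⟩ := ih hp.1
    by_cases ha : a ∈ q.support
    · refine ⟨q.dropUntil a ha, hq.dropUntil ha, fun e he => ?_, ?_⟩
      · exact List.mem_cons_of_mem _ (hqp (q.edges_dropUntil_subset_edges ha he))
      · have hc : (Walk.cons h (q.takeUntil a ha)).IsCycle := by
          rw [Walk.cons_isCycle_iff]
          exact ⟨hq.takeUntil ha, fun he =>
            hp.2 (hqp (q.edges_takeUntil_subset_edges ha he))⟩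
        have h4 := hG _ hc
        have hl := congrArg Walk.length (q.take_spec ha)
        rw [Walk.length_append] at hl
        rw [Walk.length_cons] at h4 ⊢
        omega
    · refine ⟨.cons h q, hq.cons ha, ?_, by simpa using hd⟩
      rw [Walk.edges_cons, Walk.edges_cons]
      exact List.cons_subset_cons _ hqp

lemma four_dvd_length_of_closed_trail [DecidableEq V] (hG : Multi4 G) {a : V} (p : G.Walk a a)
    (hp : p.edges.Nodup) : 4 ∣ p.length := by
  obtain ⟨q, hq, -, hd⟩ := exists_isPath_of_isTrail hG p ⟨hp⟩
  have hq0 := Walk.length_eq_zero_iff.mpr (Walk.isPath_iff_nil.mp hq)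
  omega

/-- The vertices `v 0, …, v n` form a path in `H`. -/
structure IsPathSeq (H : SimpleGraph V) (v : ℕ → V) (n : ℕ) : Prop where
  adj : ∀ l < n, H.Adj (v l) (v (l + 1))
  inj : ∀ i ≤ n, ∀ j ≤ n, v i = v j → i = j

/-- The `l`-th edge of a vertex sequence. -/
def seqEdge (v : ℕ → V) (l : ℕ) : Sym2 V := s(v l, v (l + 1))

/-- The graph `H` without the edges of the path `v 0, …, v n`. -/
def offPath (H : SimpleGraph V) (v : ℕ → V) (n : ℕ) : SimpleGraph V :=
  H.deleteEdges {e | ∃ l < n, e = seqEdge v l}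

/-- The `m`-th edge of the path is bridged by a detour of `H` that avoids the edges of the path. -/
def Covered (H : SimpleGraph V) (v : ℕ → V) (n m : ℕ) : Prop :=
  ∃ a b, a ≤ m ∧ m < b ∧ b ≤ n ∧ (offPath H v n).Reachable (v a) (v b)

lemma IsPathSeq.edge_inj (hv : IsPathSeq H v n) {i j : ℕ} (hi : i < n) (hj : j < n)
    (h : seqEdge v i = seqEdge v j) : i = j := by
  rw [seqEdge, seqEdge, Sym2.eq_iff] at h
  rcases h with ⟨h, -⟩ | ⟨h, h'⟩
  · exact hv.inj _ hi.le _ hj.le h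
  · have := hv.inj _ hi.le _ hj h
    have := hv.inj _ hi _ hj.le h'
    omega

/-- The segment of a vertex sequence between two indices, as a walk. -/
lemma exists_segment {D : SimpleGraph V} (v : ℕ → V) (a k : ℕ)
    (h : ∀ l, a ≤ l → l < a + k → D.Adj (v l) (v (l + 1))) :
    ∃ w : D.Walk (v a) (v (a + k)),
      w.edges = (List.range' a k).map (seqEdge v) ∧
      w.support = (List.range' a (k + 1)).map v := by
  induction k with
  | zero => exact ⟨.nil, by simp, by simp⟩
  | succ k ih =>
    obtain ⟨w, hw, hs⟩ := ih fun l hl hl' => h l hl (by omega)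
    refine ⟨w.concat (h (a + k) (by omega) (by omega)), ?_, ?_⟩
    · rw [Walk.edges_concat, hw, List.range'_concat]
      simp [seqEdge, add_assoc]
    · rw [Walk.support_concat, hs, List.range'_concat (n := k + 1)]
      simp

lemma exists_segment' {D : SimpleGraph V} (v : ℕ → V) {a b : ℕ} (hab : a ≤ b)
    (h : ∀ l, a ≤ l → l < b → D.Adj (v l) (v (l + 1))) :
    ∃ w : D.Walk (v a) (v b),
      w.edges = (List.range' a (b - a)).map (seqEdge v) ∧
      w.support = (List.range' a (b - a + 1)).map v := by
  obtain ⟨k, rfl⟩ := Nat.exists_eq_add_of_le hab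
  simpa using exists_segment v a k h

lemma IsPathSeq.nodup_edges (hv : IsPathSeq H v n) {a b : ℕ} (hb : b ≤ n) :
    ((List.range' a (b - a)).map (seqEdge v)).Nodup := by
  refine List.Nodup.map_on (fun i hi j hj h => ?_) List.nodup_range'
  rw [List.mem_range'_1] at hi hj
  exact hv.edge_inj (by omega) (by omega) h

/-- A closed set for all edges of `H` but the `i`-th one separates the path at an uncovered edge. -/
lemma not_reachable_of_not_covered {D : SimpleGraph V} {i : ℕ}
    (hD : ∀ u w, D.Adj u w → H.Adj u w ∧ s(u, w) ≠ seqEdge v i)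
    (hc : ¬ Covered H v n i) {a b : ℕ} (ha : a ≤ i) (hb : i < b) (hbn : b ≤ n) :
    ¬ D.Reachable (v a) (v b) := by
  have key : ∀ {s t : V}, D.Walk s t → (∃ c ≤ i, (offPath H v n).Reachable (v c) s) →
      ∃ c ≤ i, (offPath H v n).Reachable (v c) t := by
    intro s t w
    induction w with
    | nil => exact id
    | @cons s s' t h p ih =>
      rintro ⟨c, hci, hr⟩
      apply ih
      obtain ⟨hH, hne⟩ := hD _ _ h
      by_cases hl : ∃ l < n, s(s, s') = seqEdge v l
      · obtain ⟨l, hln, hl⟩ := hl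
        have hli : l ≠ i := by rintro rfl; exact hne hl
        rcases lt_or_gt_of_ne hli with hli | hli
        · rw [seqEdge, Sym2.eq_iff] at hl
          rcases hl with ⟨-, rfl⟩ | ⟨-, rfl⟩
          · exact ⟨l + 1, hli, .rfl⟩
          · exact ⟨l, hli.le, .rfl⟩
        · rw [seqEdge, Sym2.eq_iff] at hl
          rcases hl with ⟨rfl, -⟩ | ⟨rfl, -⟩
          · exact (hc ⟨c, l, hci, hli, hln.le, hr⟩).elim
          · exact (hc ⟨c, l + 1, hci, by omega, hln, hr⟩).elim
      · refine ⟨c, hci, hr.trans (Adj.reachable ?_)⟩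
        rw [offPath, deleteEdges_adj]
        exact ⟨hH, hl⟩
  rintro ⟨w⟩
  obtain ⟨c, hc', hr⟩ := key w ⟨a, ha, .rfl⟩
  exact hc ⟨c, b, hc', hb, hbn, hr⟩

lemma offPath_edges {a b : V} (w : (offPath H v n).Walk a b) {e : Sym2 V} (he : e ∈ w.edges) :
    e ∈ H.edgeSet ∧ ∀ l < n, e ≠ seqEdge v l := by
  have h := w.edges_subset_edgeSet he
  rw [offPath, edgeSet_deleteEdges] at h
  exact ⟨h.1, fun l hl hle => h.2 ⟨l, hl, hle⟩⟩

section Parity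

variable [DecidableEq V] {x y : V} {P : G.Walk x y}

lemma even_of_offPath_reachable (hG : Multi4 G) (hHG : H ≤ G) (hP : P.IsPath)
    (hPH : ∀ e ∈ P.edges, e ∉ H.edgeSet) (hv : IsPathSeq H v n) (h0 : v 0 = x) (hn : v n = y)
    {a b : ℕ} (hab : a < b) (hb : b ≤ n) (h : (offPath H v n).Reachable (v a) (v b)) :
    Even (b - a) := by
  subst h0 hn
  obtain ⟨w, hw⟩ := h.exists_isPath
  have hKG : offPath H v n ≤ G := (deleteEdges_le _).trans hHG
  have hadj : ∀ l < n, G.Adj (v l) (v (l + 1)) := fun l hl => hHG (hv.adj l hl)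
  have hvH : ∀ l < n, seqEdge v l ∈ H.edgeSet := fun l hl => hv.adj l hl
  obtain ⟨s₁, hs₁, -⟩ := exists_segment' v (Nat.zero_le a) fun l _ hl => hadj l (by omega)
  obtain ⟨s₂, hs₂, -⟩ := exists_segment' v hab.le fun l _ hl => hadj l (by omega)
  obtain ⟨s₃, hs₃, -⟩ := exists_segment' v hb fun l _ hl => hadj l (by omega)
  obtain ⟨s, hs, -⟩ := exists_segment' v (Nat.zero_le n) fun l _ hl => hadj l (by omega)
  have hwd := hw.isTrail.edges_nodup
  have hPd := hP.isTrail.edges_nodup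
  have l₁ : s₁.length = a := by rw [← Walk.length_edges, hs₁]; simp
  have l₂ : s₂.length = b - a := by rw [← Walk.length_edges, hs₂]; simp
  have l₃ : s₃.length = n - b := by rw [← Walk.length_edges, hs₃]; simp
  have l : s.length = n := by rw [← Walk.length_edges, hs]; simp
  have hmem : ∀ (i j : ℕ) (e), j ≤ n → e ∈ (List.range' i (j - i)).map (seqEdge v) →
      ∃ l, i ≤ l ∧ l < j ∧ e = seqEdge v l := by
    intro i j e hj he
    obtain ⟨l, hl, rfl⟩ := List.mem_map.mp he
    rw [List.mem_range'_1] at hl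
    exact ⟨l, hl.1, by omega, rfl⟩
  have t₁ := four_dvd_length_of_closed_trail hG (s.append P.reverse) (by
    rw [Walk.edges_append, Walk.edges_reverse, List.nodup_append', List.nodup_reverse, hs]
    refine ⟨hv.nodup_edges le_rfl, hPd, fun e he he' => ?_⟩
    obtain ⟨l, -, hl, rfl⟩ := hmem _ _ _ le_rfl he
    exact hPH _ (List.mem_reverse.mp he') (hvH _ hl))
  have t₂ := four_dvd_length_of_closed_trail hG (s₂.append (w.mapLe hKG).reverse) (by
    rw [Walk.edges_append, Walk.edges_reverse, List.nodup_append', List.nodup_reverse, hs₂,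
      Walk.edges_mapLe_eq_edges]
    refine ⟨hv.nodup_edges hb, hwd, fun e he he' => ?_⟩
    obtain ⟨l, -, hl, rfl⟩ := hmem _ _ _ hb he
    exact (offPath_edges w (List.mem_reverse.mp he')).2 l (by omega) rfl)
  have t₃ := four_dvd_length_of_closed_trail hG
    ((s₁.append (w.mapLe hKG)).append (s₃.append P.reverse)) (by
    rw [Walk.edges_append, Walk.edges_append, Walk.edges_append, Walk.edges_reverse,
      List.nodup_append', List.nodup_append', List.nodup_append', List.nodup_reverse, hs₁, hs₃,
      Walk.edges_mapLe_eq_edges]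
    refine ⟨⟨hv.nodup_edges (by omega), hwd, fun e he he' => ?_⟩,
      ⟨hv.nodup_edges le_rfl, hPd, fun e he he' => ?_⟩, fun e he he' => ?_⟩
    · obtain ⟨l, -, hl, rfl⟩ := hmem _ _ _ (by omega) he
      exact (offPath_edges w he').2 l (by omega) rfl
    · obtain ⟨l, -, hl, rfl⟩ := hmem _ _ _ le_rfl he
      exact hPH _ (List.mem_reverse.mp he') (hvH _ hl)
    · rcases List.mem_append.mp he with he | he <;> rcases List.mem_append.mp he' with he' | he'
      · obtain ⟨l, -, hl, rfl⟩ := hmem _ _ _ (by omega) he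
        obtain ⟨l', hl₁, hl₂, hll⟩ := hmem _ _ _ le_rfl he'
        have := hv.edge_inj (by omega) (by omega) hll
        omega
      · obtain ⟨l, -, hl, rfl⟩ := hmem _ _ _ (by omega) he
        exact hPH _ (List.mem_reverse.mp he') (hvH _ (by omega))
      · obtain ⟨l, -, hl, rfl⟩ := hmem _ _ _ le_rfl he'
        exact (offPath_edges w he).2 l (by omega) rfl
      · exact hPH _ (List.mem_reverse.mp he') (offPath_edges w he).1)
  simp only [Walk.length_append, Walk.length_reverse, Walk.length_map, Walk.mapLe] at t₁ t₂ t₃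
  rw [Nat.even_iff]
  omega

/-- Two crossing detours join vertices of the same parity. -/
lemma even_of_crossing (hG : Multi4 G) (hHG : H ≤ G) (hP : P.IsPath)
    (hPH : ∀ e ∈ P.edges, e ∉ H.edgeSet) (hv : IsPathSeq H v n) (h0 : v 0 = x) (hn : v n = y)
    {a b c d : ℕ} (hac : a < c) (hcb : c < b) (hbd : b < d) (hd : d ≤ n)
    (h₁ : (offPath H v n).Reachable (v a) (v b)) (h₂ : (offPath H v n).Reachable (v c) (v d)) :
    Even (c - a) := by
  have E := @even_of_offPath_reachable V G H v n _ x y P hG hHG hP hPH hv h0 hn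
  by_cases hr : (offPath H v n).Reachable (v a) (v c)
  · exact E hac (by omega) hr
  have e₁ := E (by omega) (by omega) h₁
  have e₂ := E (by omega) hd h₂
  obtain ⟨w₁, hw₁⟩ := h₁.exists_isPath
  obtain ⟨w₂, hw₂⟩ := h₂.exists_isPath
  have hKG : offPath H v n ≤ G := (deleteEdges_le _).trans hHG
  have hadj : ∀ l < n, G.Adj (v l) (v (l + 1)) := fun l hl => hHG (hv.adj l hl)
  obtain ⟨s₁, hs₁, -⟩ := exists_segment' v hac.le fun l _ hl => hadj l (by omega)
  obtain ⟨s₂, hs₂, -⟩ := exists_segment' v hbd.le fun l _ hl => hadj l (by omega)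
  obtain ⟨s₃, hs₃, -⟩ := exists_segment' v (show a ≤ b by omega) fun l _ hl => hadj l (by omega)
  obtain ⟨s₄, hs₄, -⟩ := exists_segment' v (show c ≤ d by omega) fun l _ hl => hadj l (by omega)
  have l₁ : s₁.length = c - a := by rw [← Walk.length_edges, hs₁]; simp
  have l₂ : s₂.length = d - b := by rw [← Walk.length_edges, hs₂]; simp
  have l₃ : s₃.length = b - a := by rw [← Walk.length_edges, hs₃]; simp
  have l₄ : s₄.length = d - c := by rw [← Walk.length_edges, hs₄]; simp
  have hd₁ := hw₁.isTrail.edges_nodup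
  have hd₂ := hw₂.isTrail.edges_nodup
  have hmem : ∀ (i j : ℕ) (e), j ≤ n → e ∈ (List.range' i (j - i)).map (seqEdge v) →
      ∃ l, i ≤ l ∧ l < j ∧ e = seqEdge v l := by
    intro i j e hj he
    obtain ⟨l, hl, rfl⟩ := List.mem_map.mp he
    rw [List.mem_range'_1] at hl
    exact ⟨l, hl.1, by omega, rfl⟩
  have t₁ := four_dvd_length_of_closed_trail hG (s₃.append (w₁.mapLe hKG).reverse) (by
    rw [Walk.edges_append, Walk.edges_reverse, List.nodup_append', List.nodup_reverse, hs₃,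
      Walk.edges_mapLe_eq_edges]
    refine ⟨hv.nodup_edges (by omega), hd₁, fun e he he' => ?_⟩
    obtain ⟨l, -, hl, rfl⟩ := hmem _ _ _ (by omega) he
    exact (offPath_edges w₁ (List.mem_reverse.mp he')).2 l (by omega) rfl)
  have t₂ := four_dvd_length_of_closed_trail hG (s₄.append (w₂.mapLe hKG).reverse) (by
    rw [Walk.edges_append, Walk.edges_reverse, List.nodup_append', List.nodup_reverse, hs₄,
      Walk.edges_mapLe_eq_edges]
    refine ⟨hv.nodup_edges (by omega), hd₂, fun e he he' => ?_⟩
    obtain ⟨l, -, hl, rfl⟩ := hmem _ _ _ (by omega) he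
    exact (offPath_edges w₂ (List.mem_reverse.mp he')).2 l (by omega) rfl)
  have t₃ := four_dvd_length_of_closed_trail hG
    (((w₁.mapLe hKG).append s₂).append (s₁.append (w₂.mapLe hKG)).reverse) (by
    rw [Walk.edges_append, Walk.edges_append, Walk.edges_reverse, Walk.edges_append,
      List.nodup_append', List.nodup_append', List.nodup_reverse, List.nodup_append', hs₁, hs₂,
      Walk.edges_mapLe_eq_edges, Walk.edges_mapLe_eq_edges]
    refine ⟨⟨hd₁, hv.nodup_edges (by omega), fun e he he' => ?_⟩,
      ⟨hv.nodup_edges (by omega), hd₂, fun e he he' => ?_⟩, fun e he he' => ?_⟩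
    · obtain ⟨l, -, hl, rfl⟩ := hmem _ _ _ (by omega) he'
      exact (offPath_edges w₁ he).2 l (by omega) rfl
    · obtain ⟨l, -, hl, rfl⟩ := hmem _ _ _ (by omega) he
      exact (offPath_edges w₂ he').2 l (by omega) rfl
    · rw [List.mem_reverse] at he'
      rcases List.mem_append.mp he with he | he <;> rcases List.mem_append.mp he' with he' | he'
      · obtain ⟨l, -, hl, rfl⟩ := hmem _ _ _ (by omega) he'
        exact (offPath_edges w₁ he).2 l (by omega) rfl
      · induction e with | _ p q =>
        have hp₁ := w₁.fst_mem_support_of_mem_edges he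
        have hp₂ := w₂.fst_mem_support_of_mem_edges he'
        exact hr ((w₁.takeUntil p hp₁).reachable.trans (w₂.takeUntil p hp₂).reachable.symm)
      · obtain ⟨l, hl', hl, rfl⟩ := hmem _ _ _ (by omega) he
        obtain ⟨l', hl₁, hl₂, hll⟩ := hmem _ _ _ (by omega) he'
        have := hv.edge_inj (by omega) (by omega) hll
        omega
      · obtain ⟨l, -, hl, rfl⟩ := hmem _ _ _ (by omega) he
        exact (offPath_edges w₂ he').2 l (by omega) rfl)
  simp only [Walk.length_append, Walk.length_reverse, Walk.length_map, Walk.mapLe] at t₁ t₂ t₃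
  rw [Nat.even_iff] at *
  omega

end Parity

/-- A run of covered positions, maximal to both sides, has even length. -/
lemma even_of_maximal_run {r : ℕ → ℕ → Prop} {n k i : ℕ}
    (htr : ∀ a b c, r a b → r b c → r a c)
    (hev : ∀ a b, a < b → b ≤ n → r a b → Even (b - a))
    (hcr : ∀ a b c d, a < c → c < b → b < d → d ≤ n → r a b → r c d → Even (c - a))
    (hki : k < i) (hin : i ≤ n)
    (hk : k = 0 ∨ ∀ a b, a ≤ k - 1 → k - 1 < b → b ≤ n → ¬ r a b)
    (hi : i = n ∨ ∀ a b, a ≤ i → i < b → b ≤ n → ¬ r a b)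
    (hcov : ∀ m, k ≤ m → m < i → ∃ a b, a ≤ m ∧ m < b ∧ b ≤ n ∧ r a b) :
    Even (i - k) := by
  classical
  have hlow : ∀ m a b, k ≤ m → a ≤ m → m < b → b ≤ n → r a b → k ≤ a := by
    intro m a b hm ha hb hbn hr
    rcases hk with rfl | hk
    · exact Nat.zero_le _
    · by_contra hlt
      exact hk a b (by omega) (by omega) hbn hr
  have hup : ∀ m a b, m < i → a ≤ m → m < b → b ≤ n → r a b → b ≤ i := by
    intro m a b hm ha hb hbn hr
    rcases hi with rfl | hi
    · exact hbn
    · by_contra hlt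
      exact hi a b (by omega) (by omega) hbn hr
  have hmax : ∀ m, k ≤ m → m < i → ∃ c d, k ≤ c ∧ c ≤ m ∧ m < d ∧ d ≤ i ∧ r c d ∧
      ∀ c' ≤ m, ∀ d', d < d' → d' ≤ n → ¬ r c' d' := by
    intro m hkm hmi
    obtain ⟨a, b, ha, hb, hbn, hr⟩ := hcov m hkm hmi
    let p : ℕ → Prop := fun d => m < d ∧ ∃ c ≤ m, r c d
    have hs := Nat.findGreatest_spec (P := p) hbn ⟨hb, a, ha, hr⟩
    have hle := Nat.findGreatest_le (P := p) n
    obtain ⟨hd, c, hc, hr'⟩ := hs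
    refine ⟨c, _, hlow m c _ hkm hc hd hle hr', hc, hd, hup m c _ hmi hc hd hle hr', hr', ?_⟩
    intro c' hc' d' hd' hdn hr''
    exact Nat.findGreatest_is_greatest hd' hdn ⟨by omega, c', hc', hr''⟩
  let Inv : ℕ → Prop := fun b => Even (b - k) ∧ ∃ a, k ≤ a ∧ a < b ∧ Even (a - k) ∧ r a b ∧
    ∀ c ≤ a, ∀ d, b < d → d ≤ n → ¬ r c d
  obtain ⟨b, hb, hIb⟩ : ∃ b ≤ i, Inv b := by
    obtain ⟨c, d, hkc, hck, hcd, hdi, hr, hm⟩ := hmax k le_rfl hki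
    obtain rfl : c = k := by omega
    exact ⟨d, hdi, hev _ _ hcd (by omega) hr, c, le_rfl, hcd, by simp, hr, hm⟩
  have hs := Nat.findGreatest_spec (P := Inv) hb hIb
  have hle := Nat.findGreatest_le (P := Inv) i
  set B := Nat.findGreatest Inv i with hB
  rcases hle.eq_or_lt with heq | hlt
  · rw [← heq]; exact hs.1
  · exfalso
    obtain ⟨heB, a, hka, haB, hea, hr, hI⟩ := hs
    obtain ⟨c, d, hkc, hcB, hBd, hdi, hr', hm⟩ := hmax B (by omega) hlt
    have hac : a < c := by
      by_contra h
      exact hI c (by omega) d hBd (by omega) hr'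
    have hcB' : c ≠ B := by
      rintro rfl
      exact hI a le_rfl d hBd (by omega) (htr _ _ _ hr hr')
    have h₁ := hcr a B c d hac (by omega) hBd (by omega) hr hr'
    have h₂ := hev c d (by omega) (by omega) hr'
    rw [Nat.even_iff] at *
    refine Nat.findGreatest_is_greatest (P := Inv) hBd hdi ⟨?_, c, hkc, by omega, ?_, hr', ?_⟩
    · rw [Nat.even_iff]; omega
    · rw [Nat.even_iff]; omega
    · exact fun c' hc' => hm c' (by omega)

/-- If every maximal run of a predicate on `{0, …, n - 1}` has even length, the two ends satisfy the
predicate and `n` is odd, then some maximal run of its negation goes from even to odd. -/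
lemma exists_gap {C : ℕ → Prop} {n : ℕ} (hn : Odd n) (h0 : C 0) (hlast : C (n - 1))
    (hrun : ∀ k i, k < i → i ≤ n → (k = 0 ∨ ¬ C (k - 1)) → (i = n ∨ ¬ C i) →
      (∀ m, k ≤ m → m < i → C m) → Even (i - k)) :
    ∃ i j, 0 < i ∧ i < j ∧ j < n ∧ Even i ∧ Odd j ∧ C (i - 1) ∧ C j ∧
      ∀ m, i ≤ m → m < j → ¬ C m := by
  classical
  have hn0 : 0 < n := hn.pos
  have hstart : ∀ i, 0 < i → i ≤ n → C (i - 1) → (i = n ∨ ¬ C i) →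
      ∃ k < i, (k = 0 ∨ ¬ C (k - 1)) ∧ C k ∧ Even (i - k) := by
    intro i hi hin hC hend
    have hex : ∃ k, k < i ∧ ∀ m, k ≤ m → m < i → C m :=
      ⟨i - 1, by omega, fun m h h' => by rwa [show m = i - 1 by omega]⟩
    obtain ⟨hk, hkC⟩ := Nat.find_spec hex
    have hbd : Nat.find hex = 0 ∨ ¬ C (Nat.find hex - 1) := by
      by_contra! h
      refine Nat.find_min hex (m := Nat.find hex - 1) (by omega) ⟨by omega, fun m hm hmi => ?_⟩
      rcases hm.eq_or_lt with rfl | hm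
      · exact h.2
      · exact hkC m (by omega) hmi
    exact ⟨_, hk, hbd, hkC _ le_rfl hk, hrun _ i hk hin hbd hend hkC⟩
  have hexj : ∃ j, j < n ∧ Odd j ∧ ¬ C (j - 1) ∧ C j := by
    obtain ⟨k, hk, hb, hC, he⟩ := hstart n hn0 le_rfl hlast (.inl rfl)
    have hko : Odd k := by
      rw [Nat.odd_iff] at *
      rw [Nat.even_iff] at he
      omega
    refine ⟨k, hk, hko, hb.resolve_left ?_, hC⟩
    rintro rfl
    simp at hko
  obtain ⟨hj, hjo, hjC, hjC'⟩ := Nat.find_spec hexj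
  set j := Nat.find hexj with hjdef
  have hj0 : 0 < j := hjo.pos
  let p : ℕ → Prop := fun i => 0 < i ∧ C (i - 1)
  have hj1 : 1 ≤ j - 1 := by
    by_contra h
    exact hjC (by rwa [show j - 1 = 0 by omega])
  obtain ⟨hi0, hiC⟩ := Nat.findGreatest_spec (P := p) hj1 ⟨by omega, h0⟩
  have hile := Nat.findGreatest_le (P := p) (j - 1)
  have higr : ∀ m, Nat.findGreatest p (j - 1) < m → m ≤ j - 1 → ¬ p m :=
    fun m h h' => Nat.findGreatest_is_greatest h h'
  generalize Nat.findGreatest p (j - 1) = i at *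
  have hgap : ∀ m, i ≤ m → m < j → ¬ C m := by
    intro m him hmj hC
    rcases (show m ≤ j - 1 by omega).eq_or_lt with rfl | hm
    · exact hjC hC
    · exact higr (m + 1) (by omega) (by omega) ⟨by omega, by simpa using hC⟩
  refine ⟨i, j, hi0, by omega, hj, ?_, hjo, hiC, hjC', hgap⟩
  by_contra hie
  obtain ⟨k, hk, hb, hC, he⟩ := hstart i hi0 (by omega) hiC (.inr (hgap i le_rfl (by omega)))
  have hko : Odd k := by
    rw [Nat.not_even_iff] at hie
    rw [Nat.even_iff] at he
    rw [Nat.odd_iff]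
    omega
  refine Nat.find_min hexj (m := k) (by omega) ⟨by omega, hko, hb.resolve_left ?_, hC⟩
  rintro rfl
  simp at hko

lemma three_le_degree [Fintype V] [DecidableEq V] [DecidableRel G.Adj] {w p q r : V}
    (hp : G.Adj w p) (hq : G.Adj w q) (hr : G.Adj w r) (hpq : p ≠ q) (hpr : p ≠ r) (hqr : q ≠ r) :
    3 ≤ G.degree w := by
  rw [← Finset.card_eq_three.mpr ⟨p, q, r, hpq, hpr, hqr, rfl⟩, ← card_neighborFinset_eq_degree]
  refine Finset.card_le_card fun t ht => ?_
  simp only [Finset.mem_insert, Finset.mem_singleton] at ht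
  rw [mem_neighborFinset]
  rcases ht with rfl | rfl | rfl <;> assumption

section PathEdges

variable {a b : V}

lemma eq_getVert_one_of_mem_edges {Q : G.Walk a b} (hQ : Q.IsPath) {z : V}
    (h : s(a, z) ∈ Q.edges) : z = Q.getVert 1 := by
  obtain ⟨i, hi, h⟩ := (Walk.mk_mem_edges_iff_exists Q).mp h
  rw [Sym2.eq_iff] at h
  rcases h with ⟨h, h'⟩ | ⟨h, h'⟩
  · have : i = 0 := hQ.getVert_injOn (by simp; omega) (by simp) (by simpa using h)
    subst this
    exact h'.symm
  · have : i + 1 = 0 := hQ.getVert_injOn (by simp; omega) (by simp) (by simpa using h')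
    omega

lemma getVert_mem_innSet {Q : G.Walk a b} (hQ : Q.IsPath) {i : ℕ} (hi : 0 < i)
    (hil : i < Q.length) : Q.getVert i ∈ innSet Q := by
  refine ⟨Q.getVert_mem_support i, fun h => ?_, fun h => ?_⟩
  · have : i = 0 := hQ.getVert_injOn (by simp; omega) (by simp) (by simpa using h)
    omega
  · have : i = Q.length := hQ.getVert_injOn (by simp; omega) (by simp) (by simpa using h)
    omega

lemma mem_edges_of_mem_innSet [Fintype V] [DecidableEq V] [DecidableRel G.Adj] {Q : G.Walk a b}
    (hQ : Q.IsPath) {w : V} (hw : w ∈ innSet Q) (hd : G.degree w = 2) {u : V} (h : G.Adj w u) :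
    s(w, u) ∈ Q.edges := by
  obtain ⟨hwQ, hwa, hwb⟩ := hw
  obtain ⟨i, rfl, hi⟩ := Walk.mem_support_iff_exists_getVert.mp hwQ
  have hi0 : i ≠ 0 := by rintro rfl; simp at hwa
  have hil : i ≠ Q.length := by rintro rfl; simp at hwb
  obtain ⟨j, rfl⟩ := Nat.exists_eq_succ_of_ne_zero hi0
  rw [Nat.succ_eq_add_one] at *
  by_contra hu
  rw [Walk.mk_mem_edges_iff_exists] at hu
  push Not at hu
  have h₁ := hu j (by omega)
  have h₂ := hu (j + 1) (by omega)
  have a₁ : G.Adj (Q.getVert (j + 1)) (Q.getVert j) := (Q.adj_getVert_succ (by omega)).symm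
  have a₂ : G.Adj (Q.getVert (j + 1)) (Q.getVert (j + 1 + 1)) := Q.adj_getVert_succ (by omega)
  have hne : Q.getVert j ≠ Q.getVert (j + 1 + 1) := by
    intro he
    have : j = j + 1 + 1 := hQ.getVert_injOn (by simp; omega) (by simp; omega) he
    omega
  have h3 := three_le_degree a₁ a₂ h hne (by rintro rfl; exact h₁ Sym2.eq_swap)
    (by rintro rfl; exact h₂ rfl)
  omega

/-- An edge of a path whose inner vertices have all their edges on the path is exactly an edge
destroyed by removing the interior of the path. -/
lemma mem_edges_iff {Q : G.Walk a b} (hQ : Q.IsPath)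
    (hin : ∀ w ∈ innSet Q, ∀ u, G.Adj w u → s(w, u) ∈ Q.edges) {u w : V} (h : G.Adj u w) :
    s(u, w) ∈ Q.edges ↔
      u ∈ innSet Q ∨ w ∈ innSet Q ∨ (Q.length = 1 ∧ s(u, w) ∈ Q.edges) := by
  constructor
  · intro he
    by_cases hl : Q.length = 1
    · exact .inr (.inr ⟨hl, he⟩)
    obtain ⟨i, hi, hs⟩ := (Walk.mk_mem_edges_iff_exists Q).mp he
    rw [Sym2.eq_iff] at hs
    have hmem : Q.getVert i ∈ innSet Q ∨ Q.getVert (i + 1) ∈ innSet Q := by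
      rcases Nat.eq_zero_or_pos i with rfl | h0
      · exact .inr (getVert_mem_innSet hQ (by omega) (by omega))
      · exact .inl (getVert_mem_innSet hQ h0 hi)
    rcases hs with ⟨rfl, rfl⟩ | ⟨rfl, rfl⟩ <;> tauto
  · rintro (hu | hw | ⟨-, he⟩)
    · exact hin _ hu _ h
    · rw [Sym2.eq_swap]
      exact hin _ hw _ h.symm
    · exact he

lemma removeInt_adj {Q : G.Walk a b} (hQ : Q.IsPath)
    (hin : ∀ w ∈ innSet Q, ∀ u, G.Adj w u → s(w, u) ∈ Q.edges) {u w : V} :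
    (removeInt Q).Adj u w ↔ G.Adj u w ∧ s(u, w) ∉ Q.edges := by
  by_cases h : G.Adj u w
  · rw [mem_edges_iff hQ hin h, removeInt, Subgraph.deleteEdges_adj, Subgraph.deleteVerts_adj]
    split_ifs with hl <;> simp [h, hl]
    tauto
  · simp [removeInt, h]

lemma removeInt2_adj {c d : V} {P : G.Walk a b} {Q : G.Walk c d} (hP : P.IsPath) (hQ : Q.IsPath)
    (hinP : ∀ w ∈ innSet P, ∀ u, G.Adj w u → s(w, u) ∈ P.edges)
    (hinQ : ∀ w ∈ innSet Q, ∀ u, G.Adj w u → s(w, u) ∈ Q.edges) {u w : V} :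
    (removeInt2 P Q).spanningCoe.Adj u w ↔
      G.Adj u w ∧ s(u, w) ∉ P.edges ∧ s(u, w) ∉ Q.edges := by
  rw [Subgraph.spanningCoe_adj]
  by_cases h : G.Adj u w
  · rw [mem_edges_iff hP hinP h, mem_edges_iff hQ hinQ h, removeInt2, Subgraph.deleteEdges_adj,
      Subgraph.deleteVerts_adj]
    split_ifs with hl hl' hl' <;> simp [h, hl, hl'] <;> tauto
  · simp [removeInt2, h]

end PathEdges

lemma exists_adj_ne_ne [Fintype V] [DecidableEq V] [DecidableRel G.Adj] {w : V}
    (h : 3 ≤ G.degree w) (p q : V) : ∃ z, G.Adj w z ∧ z ≠ p ∧ z ≠ q := by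
  have hlt : ({p, q} : Finset V).card < (G.neighborFinset w).card :=
    Finset.card_le_two.trans_lt (by rw [card_neighborFinset_eq_degree]; omega)
  obtain ⟨z, hz, hzn⟩ := Finset.exists_mem_notMem_of_card_lt_card hlt
  rw [mem_neighborFinset] at hz
  simp only [Finset.mem_insert, Finset.mem_singleton, not_or] at hzn
  exact ⟨z, hz, hzn⟩

lemma exists_walk_of_induce {w : V} {s t : ({w}ᶜ : Set V)}
    (p : (G.induce ({w}ᶜ : Set V)).Walk s t) :
    ∃ q : G.Walk s.1 t.1, w ∉ q.support := by
  induction p with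
  | @nil s => exact ⟨.nil, fun h => s.2 (by simpa using h : w = s.1).symm⟩
  | @cons s s' t h p ih =>
    obtain ⟨q, hq⟩ := ih
    have h' : G.Adj s.1 s'.1 := h
    refine ⟨.cons h' q, ?_⟩
    rw [Walk.support_cons, List.mem_cons, not_or]
    exact ⟨fun he => s.2 he.symm, hq⟩

lemma exists_walk_avoiding {w z t : V} (h : (G.induce ({w}ᶜ : Set V)).Preconnected) (hz : z ≠ w)
    (ht : t ≠ w) : ∃ p : G.Walk z t, w ∉ p.support := by
  obtain ⟨p⟩ := h ⟨z, hz⟩ ⟨t, ht⟩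
  exact exists_walk_of_induce p

section Detour

variable {x y : V} {P : G.Walk x y}

lemma exists_walk_to_ends (hin : ∀ w ∈ innSet P, ∀ u, G.Adj w u → s(w, u) ∈ P.edges)
    {w z t : V} (p : G.Walk z t) (hw : w ∉ p.support) (ht : t = x ∨ t = y) (hz : z ∉ innSet P) :
    ∃ t', (t' = x ∨ t' = y) ∧
      ∃ q : (G.deleteEdges {e | e ∈ P.edges}).Walk z t', w ∉ q.support := by
  induction p with
  | nil => exact ⟨_, ht, .nil, by simpa using hw⟩
  | @cons z z' t h p ih =>
    rw [Walk.support_cons, List.mem_cons, not_or] at hw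
    by_cases hzP : z ∈ P.support
    · refine ⟨z, ?_, .nil, by simpa using hw.1⟩
      by_contra! hne
      exact hz ⟨hzP, hne⟩
    · have he : s(z, z') ∉ P.edges := fun he => hzP (P.fst_mem_support_of_mem_edges he)
      obtain ⟨t', ht', q, hq⟩ := ih hw.2 ht fun hz' => he (Sym2.eq_swap ▸ hin _ hz' _ h.symm)
      have hH : (G.deleteEdges {e | e ∈ P.edges}).Adj z z' := by
        rw [deleteEdges_adj]; exact ⟨h, he⟩
      exact ⟨t', ht', .cons hH q, by simp [hw.1, hq]⟩

lemma exists_offPath_reachable {w z t : V} (p : H.Walk z t) (hw : w ∉ p.support)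
    (ht : ∃ b ≤ n, t = v b) : ∃ b ≤ n, v b ≠ w ∧ (offPath H v n).Reachable z (v b) := by
  induction p with
  | nil =>
    obtain ⟨b, hb, rfl⟩ := ht
    exact ⟨b, hb, fun h => hw (by simp [h]), .rfl⟩
  | @cons z z' t h p ih =>
    rw [Walk.support_cons, List.mem_cons, not_or] at hw
    by_cases hz : ∃ b ≤ n, z = v b
    · obtain ⟨b, hb, rfl⟩ := hz
      exact ⟨b, hb, Ne.symm hw.1, .rfl⟩
    · obtain ⟨b, hb, hbw, hr⟩ := ih hw.2 ht
      refine ⟨b, hb, hbw, (Adj.reachable ?_).trans hr⟩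
      rw [offPath, deleteEdges_adj]
      refine ⟨h, ?_⟩
      rintro ⟨l, hl, he⟩
      rw [seqEdge, Sym2.eq_iff] at he
      rcases he with ⟨rfl, -⟩ | ⟨rfl, -⟩
      · exact hz ⟨l, hl.le, rfl⟩
      · exact hz ⟨l + 1, hl, rfl⟩

/-- In a 2-connected graph, an edge off the path at a vertex of the path starts a detour. -/
lemma exists_detour (h2 : TwoConn G)
    (hin : ∀ w ∈ innSet P, ∀ u, G.Adj w u → s(w, u) ∈ P.edges) (hxy : x ≠ y)
    (h0 : v 0 = x) (hn : v n = y) {m : ℕ} {z : V}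
    (hz : (G.deleteEdges {e | e ∈ P.edges}).Adj (v m) z)
    (hzl : ∀ l < n, s(v m, z) ≠ seqEdge v l) :
    ∃ b ≤ n, b ≠ m ∧
      (offPath (G.deleteEdges {e | e ∈ P.edges}) v n).Reachable (v m) (v b) := by
  obtain ⟨hG, hzP⟩ := deleteEdges_adj.mp hz
  obtain ⟨t, ht, htm⟩ : ∃ t, (t = x ∨ t = y) ∧ t ≠ v m := by
    by_cases h : x = v m
    · exact ⟨y, .inr rfl, fun h' => hxy (h.trans h'.symm)⟩
    · exact ⟨x, .inl rfl, h⟩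
  obtain ⟨p, hp⟩ := exists_walk_avoiding (h2.2.2 (v m)) hG.ne' htm
  obtain ⟨t', ht', q, hq⟩ := exists_walk_to_ends hin p hp ht fun hi =>
    hzP (Sym2.eq_swap ▸ hin _ hi _ hG.symm)
  obtain ⟨b, hb, hbm, hr⟩ := exists_offPath_reachable (v := v) (n := n) q hq (by
    rcases ht' with rfl | rfl
    · exact ⟨0, Nat.zero_le _, h0.symm⟩
    · exact ⟨n, le_rfl, hn.symm⟩)
  refine ⟨b, hb, fun h => hbm (h ▸ rfl), (Adj.reachable ?_).trans hr⟩
  rw [offPath, deleteEdges_adj]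
  exact ⟨hz, fun ⟨l, hl, he⟩ => hzl l hl he⟩

lemma exists_isPathSeq [Fintype V] [DecidableEq V] [DecidableRel G.Adj] (h2 : TwoConn G)
    (hin : ∀ w ∈ innSet P, ∀ u, G.Adj w u → s(w, u) ∈ P.edges) (hP : P.IsPath) (hxy : x ≠ y)
    (hdx : 3 ≤ G.degree x) :
    ∃ (v : ℕ → V) (n : ℕ), IsPathSeq (G.deleteEdges {e | e ∈ P.edges}) v n ∧ v 0 = x ∧ v n = y := by
  obtain ⟨z, hz, hzP, -⟩ := exists_adj_ne_ne hdx (P.getVert 1) x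
  have he : s(x, z) ∉ P.edges := fun he => hzP (eq_getVert_one_of_mem_edges hP he)
  obtain ⟨p, hp⟩ := exists_walk_avoiding (h2.2.2 x) hz.ne' hxy.symm
  obtain ⟨t, ht, q, hq⟩ := exists_walk_to_ends hin p hp (.inr rfl) fun hi =>
    he (Sym2.eq_swap ▸ hin _ hi _ hz.symm)
  obtain rfl : t = y := by
    rcases ht with rfl | h
    · exact (hq q.end_mem_support).elim
    · exact h
  have hH : (G.deleteEdges {e | e ∈ P.edges}).Adj x z := by
    rw [deleteEdges_adj]; exact ⟨hz, he⟩
  obtain ⟨r, hr⟩ := (hH.reachable.trans q.reachable).exists_isPath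
  exact ⟨r.getVert, r.length, ⟨fun l hl => r.adj_getVert_succ hl,
    fun i hi j hj h => hr.getVert_injOn hi hj h⟩, r.getVert_zero, r.getVert_length⟩

end Detour

lemma notMem_innSet_of_adj {x y : V} {P : G.Walk x y}
    (hin : ∀ w ∈ innSet P, ∀ u, G.Adj w u → s(w, u) ∈ P.edges)
    {u w : V} (h : (G.deleteEdges {e | e ∈ P.edges}).Adj u w) : u ∉ innSet P := fun hu =>
  (deleteEdges_adj.mp h).2 (hin _ hu _ (deleteEdges_adj.mp h).1)

section Degrees

variable [Fintype V] [DecidableEq V] [DecidableRel G.Adj] {x y : V} {P : G.Walk x y}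

lemma three_le_degree_of_offPath_reachable (hHG : H ≤ G) (hv : IsPathSeq H v n) {m b : ℕ}
    (hm0 : 0 < m) (hmn : m < n) (hb : b ≤ n) (hbm : b ≠ m)
    (h : (offPath H v n).Reachable (v m) (v b)) : 3 ≤ G.degree (v m) := by
  obtain ⟨w⟩ := h
  have hnil : ¬ w.Nil := fun h => hbm (hv.inj _ hb _ hmn.le h.eq.symm)
  have hz := w.adj_snd hnil
  generalize w.snd = z at hz
  rw [offPath, deleteEdges_adj] at hz
  obtain ⟨m, rfl⟩ := Nat.exists_eq_succ_of_ne_zero hm0.ne'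
  rw [Nat.succ_eq_add_one] at *
  refine three_le_degree (hHG (hv.adj m (by omega))).symm (hHG (hv.adj (m + 1) hmn)) (hHG hz.1)
    ?_ ?_ ?_
  · intro h
    have := hv.inj _ (by omega) _ (by omega) h
    omega
  · rintro rfl
    exact hz.2 ⟨m, by omega, Sym2.eq_swap⟩
  · rintro rfl
    exact hz.2 ⟨m + 1, hmn, rfl⟩

lemma degree_eq_two_of_not_covered (h2 : TwoConn G)
    (hin : ∀ w ∈ innSet P, ∀ u, G.Adj w u → s(w, u) ∈ P.edges) (hxy : x ≠ y)
    (hv : IsPathSeq (G.deleteEdges {e | e ∈ P.edges}) v n)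
    (h0 : v 0 = x) (hn : v n = y) {m : ℕ} (hm : m + 1 < n)
    (hc : ¬ Covered (G.deleteEdges {e | e ∈ P.edges}) v n m)
    (hc' : ¬ Covered (G.deleteEdges {e | e ∈ P.edges}) v n (m + 1)) :
    G.degree (v (m + 1)) = 2 := by
  have a₁ := (hv.adj m (by omega)).symm
  have a₂ := hv.adj (m + 1) hm
  have hne : v m ≠ v (m + 1 + 1) := by
    intro h
    have := hv.inj _ (by omega) _ (by omega) h
    omega
  have hP : v (m + 1) ∉ P.support := by
    intro hs
    refine notMem_innSet_of_adj hin a₁ ⟨hs, ?_, ?_⟩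
    · rw [← h0]
      intro h
      have := hv.inj _ (by omega) _ (by omega) h
      omega
    · rw [← hn]
      intro h
      have := hv.inj _ (by omega) _ (by omega) h
      omega
  rw [← card_neighborFinset_eq_degree, ← Finset.card_pair hne]
  congr 1
  ext z
  rw [mem_neighborFinset, Finset.mem_insert, Finset.mem_singleton]
  constructor
  · intro hz
    by_contra! hzn
    have hH : (G.deleteEdges {e | e ∈ P.edges}).Adj (v (m + 1)) z := by
      rw [deleteEdges_adj]
      exact ⟨hz, fun he => hP (P.fst_mem_support_of_mem_edges he)⟩
    obtain ⟨b, hb, hbm, hr⟩ := exists_detour h2 hin hxy h0 hn hH (by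
      intro l hl he
      rw [seqEdge, Sym2.eq_iff] at he
      rcases he with ⟨h, rfl⟩ | ⟨h, rfl⟩
      · obtain rfl := hv.inj _ (by omega) _ (by omega) h
        exact hzn.2 rfl
      · have := hv.inj _ (by omega) _ (by omega) h
        obtain rfl : m = l := by omega
        exact hzn.1 rfl)
    rcases lt_or_gt_of_ne hbm with hlt | hlt
    · exact hc ⟨b, m + 1, by omega, by omega, by omega, hr.symm⟩
    · exact hc' ⟨m + 1, b, le_rfl, hlt, hb, hr⟩
  · rintro (rfl | rfl)
    · exact (deleteEdges_adj.mp a₁).1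
    · exact (deleteEdges_adj.mp a₂).1

end Degrees

lemma reachable_of_subgraph_adj {B : G.Subgraph} (hB : TwoConn B.coe) {D : SimpleGraph V} {u w : V}
    (huw : B.Adj u w) (hD : ∀ s t, B.Adj s t → s(s, t) ≠ s(u, w) → D.Adj s t) :
    D.Reachable u w := by
  have hu := huw.fst_mem
  have hw := huw.snd_mem
  have hne : u ≠ w := huw.ne
  obtain ⟨c, hcu, hcw⟩ : ∃ c : B.verts, c.1 ≠ u ∧ c.1 ≠ w := by
    obtain ⟨a, b, c, hab, hac, hbc⟩ := hB.2.1
    by_contra! h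
    have ha := h a
    have hb := h b
    have hc := h c
    rw [ne_eq, Subtype.ext_iff] at hab hac hbc
    by_cases h₁ : a.1 = u <;> by_cases h₂ : b.1 = u <;> by_cases h₃ : c.1 = u <;> simp_all
  have key : ∀ d ∈ B.verts, (d = u ∨ d = w) → ∀ s ∈ B.verts, s ≠ d → ∀ t ∈ B.verts, t ≠ d →
      D.Reachable s t := by
    intro d hd hduw s hs hsd t ht htd
    have hs' : (⟨s, hs⟩ : B.verts) ∈ ({⟨d, hd⟩}ᶜ : Set B.verts) := by simpa using hsd
    have ht' : (⟨t, ht⟩ : B.verts) ∈ ({⟨d, hd⟩}ᶜ : Set B.verts) := by simpa using htd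
    let f : B.coe.induce ({⟨d, hd⟩}ᶜ : Set B.verts) →g D :=
      { toFun := fun z => z.1.1
        map_rel' := by
          rintro ⟨⟨p, hp⟩, hpd⟩ ⟨⟨q, hq⟩, hqd⟩ hpq
          have hpd' : p ≠ d := by simpa using hpd
          have hqd' : q ≠ d := by simpa using hqd
          refine hD p q hpq fun he => ?_
          rw [Sym2.eq_iff] at he
          grind }
    exact (hB.2.2 ⟨d, hd⟩ ⟨_, hs'⟩ ⟨_, ht'⟩).map f
  exact (key w hw (.inr rfl) u hu hne c c.2 hcw).trans
    (key u hu (.inl rfl) c c.2 hcu w hw hne.symm)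

lemma mem_iff_even {A : Set V} (hbip : Bipartition G A) (hHG : H ≤ G) (hv : IsPathSeq H v n)
    (h0 : v 0 ∈ A) {m : ℕ} (hm : m ≤ n) : v m ∈ A ↔ Even m := by
  induction m with
  | zero => simpa using h0
  | succ m ih =>
    have := hbip (hHG (hv.adj m (by omega)))
    rw [Nat.even_add_one, ← ih (by omega)]
    tauto

section Gap

variable [Fintype V] [DecidableEq V] [DecidableRel G.Adj] {x y : V} {P : G.Walk x y}

/-- The position of the partner path: a maximal run of uncovered edges from type α to type β. -/
lemma exists_uncovered_run {A : Set V} (hG : Multi4 G) (hbip : Bipartition G A) (h2 : TwoConn G)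
    (hP : P.IsPath) (hin : ∀ w ∈ innSet P, ∀ u, G.Adj w u → s(w, u) ∈ P.edges)
    (hxA : x ∈ A) (hyA : y ∉ A) (hdx : 3 ≤ G.degree x) (hdy : 3 ≤ G.degree y)
    (hv : IsPathSeq (G.deleteEdges {e | e ∈ P.edges}) v n) (h0 : v 0 = x) (hn : v n = y) :
    ∃ i j, 0 < i ∧ i < j ∧ j < n ∧ v i ∈ A ∧ v j ∉ A ∧
      3 ≤ G.degree (v i) ∧ 3 ≤ G.degree (v j) ∧
      ∀ m, i ≤ m → m < j → ¬ Covered (G.deleteEdges {e | e ∈ P.edges}) v n m := by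
  have hHG : G.deleteEdges {e | e ∈ P.edges} ≤ G := deleteEdges_le _
  have hPH : ∀ e ∈ P.edges, e ∉ (G.deleteEdges {e | e ∈ P.edges}).edgeSet := by
    intro e he heH
    rw [edgeSet_deleteEdges] at heH
    exact heH.2 he
  have hxy : x ≠ y := fun h => hyA (h ▸ hxA)
  have hA : ∀ m ≤ n, (v m ∈ A ↔ Even m) := fun m hm => mem_iff_even hbip hHG hv (h0 ▸ hxA) hm
  have hnodd : Odd n := by
    rw [← Nat.not_even_iff_odd, ← hA n le_rfl, hn]
    exact hyA
  have hnpos := hnodd.pos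
  have hc0 : Covered (G.deleteEdges {e | e ∈ P.edges}) v n 0 := by
    obtain ⟨z, hz, hzP, hz1⟩ := exists_adj_ne_ne hdx (P.getVert 1) (v 1)
    have hH : (G.deleteEdges {e | e ∈ P.edges}).Adj (v 0) z := by
      rw [deleteEdges_adj, h0]
      exact ⟨hz, fun he => hzP (eq_getVert_one_of_mem_edges hP he)⟩
    obtain ⟨b, hb, hb0, hr⟩ := exists_detour h2 hin hxy h0 hn hH (by
      intro l hl he
      rw [seqEdge, Sym2.eq_iff] at he
      rcases he with ⟨h, rfl⟩ | ⟨h, rfl⟩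
      · obtain rfl := hv.inj _ (by omega) _ (by omega) h
        exact hz1 rfl
      · have := hv.inj _ (by omega) _ (by omega) h
        omega)
    exact ⟨0, b, le_rfl, by omega, hb, hr⟩
  have hcn : Covered (G.deleteEdges {e | e ∈ P.edges}) v n (n - 1) := by
    obtain ⟨z, hz, hzP, hz1⟩ := exists_adj_ne_ne hdy (P.reverse.getVert 1) (v (n - 1))
    have hH : (G.deleteEdges {e | e ∈ P.edges}).Adj (v n) z := by
      rw [deleteEdges_adj, hn]
      exact ⟨hz, fun he => hzP (eq_getVert_one_of_mem_edges hP.reverse (by simpa using he))⟩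
    obtain ⟨b, hb, hb0, hr⟩ := exists_detour h2 hin hxy h0 hn hH (by
      intro l hl he
      rw [seqEdge, Sym2.eq_iff] at he
      rcases he with ⟨h, rfl⟩ | ⟨h, rfl⟩
      · have := hv.inj _ (by omega) _ (by omega) h
        omega
      · have := hv.inj _ (by omega) _ (by omega) h
        exact hz1 (by rw [this]; rfl))
    exact ⟨b, n, by omega, by omega, le_rfl, hr.symm⟩
  obtain ⟨i, j, hi, hij, hj, hie, hjo, hCi, hCj, hgap⟩ := exists_gap
    (C := Covered (G.deleteEdges {e | e ∈ P.edges}) v n) hnodd hc0 hcn (by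
    intro k i hki hin' hk hi hcov
    refine even_of_maximal_run (n := n)
      (r := fun a b => (offPath (G.deleteEdges {e | e ∈ P.edges}) v n).Reachable (v a) (v b))
      (fun _ _ _ => Reachable.trans)
      (fun a b hab hb h => even_of_offPath_reachable hG hHG hP hPH hv h0 hn hab hb h)
      (fun a b c d hac hcb hbd hd h h' =>
        even_of_crossing hG hHG hP hPH hv h0 hn hac hcb hbd hd h h')
      hki hin' (hk.imp_right ?_) (hi.imp_right ?_) hcov
    · exact fun h a b h₁ h₂ h₃ h₄ => h ⟨a, b, h₁, h₂, h₃, h₄⟩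
    · exact fun h a b h₁ h₂ h₃ h₄ => h ⟨a, b, h₁, h₂, h₃, h₄⟩)
  refine ⟨i, j, hi, hij, hj, (hA i (by omega)).mpr hie, ?_, ?_, ?_, hgap⟩
  · rw [hA j hj.le, Nat.not_even_iff_odd]
    exact hjo
  · obtain ⟨a, b, ha, hb, hbn, hr⟩ := hCi
    have hbi : b = i := by
      by_contra hne
      exact hgap i le_rfl hij ⟨a, b, by omega, by omega, hbn, hr⟩
    subst hbi
    exact three_le_degree_of_offPath_reachable hHG hv hi (by omega) (by omega) (by omega) hr.symm
  · obtain ⟨a, b, ha, hb, hbn, hr⟩ := hCj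
    have haj : a = j := by
      by_contra hne
      exact hgap (j - 1) (by omega) (by omega) ⟨a, b, by omega, by omega, hbn, hr⟩
    subst haj
    exact three_le_degree_of_offPath_reachable hHG hv (by omega) hj hbn (by omega) hr

end Gap

/-- If the inner vertices of two disjoint paths have all their edges on these paths, every other
vertex is joined to one of the four ends after removing the edges of both paths. -/
lemma exists_reachable_end {x y a b z t : V} {P : G.Walk x y} {Q : G.Walk a b} {D : SimpleGraph V}
    (hD : ∀ u w, G.Adj u w → s(u, w) ∉ P.edges → s(u, w) ∉ Q.edges → D.Adj u w)
    (hinP : ∀ w ∈ innSet P, ∀ u, G.Adj w u → s(w, u) ∈ P.edges)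
    (hinQ : ∀ w ∈ innSet Q, ∀ u, G.Adj w u → s(w, u) ∈ Q.edges)
    (p : G.Walk z t) (ht : t = x) (hzP : z ∉ innSet P) (hzQ : z ∉ innSet Q) :
    ∃ t, (t = x ∨ t = y ∨ t = a ∨ t = b) ∧ D.Reachable t z := by
  induction p with
  | nil => exact ⟨_, .inl ht, .rfl⟩
  | @cons z z' t h p ih =>
    by_cases hP : z ∈ P.support
    · refine ⟨z, ?_, .rfl⟩
      by_contra! hne
      exact hzP ⟨hP, hne.1, hne.2.1⟩
    by_cases hQ : z ∈ Q.support
    · refine ⟨z, ?_, .rfl⟩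
      by_contra! hne
      exact hzQ ⟨hQ, hne.2.2⟩
    have heP : s(z, z') ∉ P.edges := fun he => hP (P.fst_mem_support_of_mem_edges he)
    have heQ : s(z, z') ∉ Q.edges := fun he => hQ (Q.fst_mem_support_of_mem_edges he)
    obtain ⟨t, ht, hr⟩ := ih ht (fun hi => heP (Sym2.eq_swap ▸ hinP _ hi _ h.symm))
      (fun hi => heQ (Sym2.eq_swap ▸ hinQ _ hi _ h.symm))
    exact ⟨t, ht, hr.trans (hD _ _ h heP heQ).reachable.symm⟩

end CutPartner

open CutPartner

/-- Lemma 2.4.  For every path `P` with inner vertices of degree 2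
and endpoints of different types of degree at least 3, and every 2-connected block `B`
of `G − Int P`, there is a path `Q` such that `(P, Q)` cuts `G` and `B` is contained
in one of the two components of `G − (Int P ∪ Int Q)`. -/
theorem exists_cutting_partner_path {V : Type*} [Fintype V] [DecidableEq V]
    (G : SimpleGraph V) [DecidableRel G.Adj] (A : Set V)
    (hG : Multi4 G) (hbip : Bipartition G A) (h2 : TwoConn G)
    {x y : V} (P : G.Walk x y) (hP : P.IsPath) (hlen : 1 ≤ P.length)
    (hinner : ∀ w ∈ innSet P, G.degree w = 2)
    (hxA : x ∈ A) (hyA : y ∉ A) (hdx : 3 ≤ G.degree x) (hdy : 3 ≤ G.degree y)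
    (B : G.Subgraph) (hB : IsBlockOf G B (removeInt P)) (hB2 : TwoConn B.coe) :
    ∃ (x₂ y₂ : V) (Q : G.Walk x₂ y₂), Cuts G A P Q ∧
      ((∀ w ∈ B.verts, (removeInt2 P Q).spanningCoe.Reachable x w) ∨
        (∀ w ∈ B.verts, (removeInt2 P Q).spanningCoe.Reachable y w)) := by
  have hinP : ∀ w ∈ innSet P, ∀ u, G.Adj w u → s(w, u) ∈ P.edges := fun w hw _ h =>
    mem_edges_of_mem_innSet hP hw (hinner w hw) h
  have hxy : x ≠ y := fun h => hyA (h ▸ hxA)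
  obtain ⟨v, n, hv, h0, hn⟩ := exists_isPathSeq h2 hinP hP hxy hdx
  obtain ⟨i, j, hi, hij, hj, hiA, hjA, hdi, hdj, hgap⟩ :=
    exists_uncovered_run hG hbip h2 hP hinP hxA hyA hdx hdy hv h0 hn
  have hadj : ∀ l < n, G.Adj (v l) (v (l + 1)) := fun l hl => deleteEdges_le _ (hv.adj l hl)
  obtain ⟨Q, hQe, hQs⟩ := exists_segment' v hij.le fun l _ hl => hadj l (by omega)
  have hQedge : ∀ e, e ∈ Q.edges ↔ ∃ l, i ≤ l ∧ l < j ∧ seqEdge v l = e := by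
    intro e
    rw [hQe, List.mem_map]
    simp only [List.mem_range'_1, and_assoc]
    constructor
    · rintro ⟨l, h₁, h₂, h₃⟩; exact ⟨l, h₁, by omega, h₃⟩
    · rintro ⟨l, h₁, h₂, h₃⟩; exact ⟨l, h₁, by omega, h₃⟩
  have hQsupp : ∀ w, w ∈ Q.support ↔ ∃ l, i ≤ l ∧ l ≤ j ∧ v l = w := by
    intro w
    rw [hQs, List.mem_map]
    simp only [List.mem_range'_1, and_assoc]
    constructor
    · rintro ⟨l, h₁, h₂, h₃⟩; exact ⟨l, h₁, by omega, h₃⟩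
    · rintro ⟨l, h₁, h₂, h₃⟩; exact ⟨l, h₁, by omega, h₃⟩
  have hQ : Q.IsPath := by
    rw [Walk.isPath_def, hQs]
    refine List.Nodup.map_on (fun a ha b hb h => ?_) List.nodup_range'
    rw [List.mem_range'_1] at ha hb
    exact hv.inj _ (by omega) _ (by omega) h
  have hQlen : Q.length = j - i := by rw [← Walk.length_edges, hQe]; simp
  have hQdeg : ∀ w ∈ innSet Q, G.degree w = 2 := by
    rintro w ⟨hw, hwi, hwj⟩
    obtain ⟨l, hil, hlj, rfl⟩ := (hQsupp w).mp hw
    have hli : l ≠ i := by rintro rfl; exact hwi rfl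
    have hlj' : l ≠ j := by rintro rfl; exact hwj rfl
    obtain ⟨m, rfl⟩ := Nat.exists_eq_succ_of_ne_zero (show l ≠ 0 by omega)
    exact degree_eq_two_of_not_covered h2 hinP hxy hv h0 hn (by omega)
      (hgap m (by omega) (by omega)) (hgap (m + 1) hil (by omega))
  have hinQ : ∀ w ∈ innSet Q, ∀ u, G.Adj w u → s(w, u) ∈ Q.edges := fun w hw _ h =>
    mem_edges_of_mem_innSet hQ hw (hQdeg w hw) h
  have hdisj : ∀ w ∈ P.support, w ∉ Q.support := by
    intro w hw hwQ
    obtain ⟨l, hil, hlj, rfl⟩ := (hQsupp w).mp hwQ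
    refine notMem_innSet_of_adj hinP (hv.adj l (by omega)) ⟨hw, ?_, ?_⟩
    · rw [← h0]
      intro h
      have := hv.inj _ (by omega) _ (by omega) h
      omega
    · rw [← hn]
      intro h
      have := hv.inj _ (by omega) _ (by omega) h
      omega
  have hD : ∀ u w, (removeInt2 P Q).spanningCoe.Adj u w ↔
      G.Adj u w ∧ s(u, w) ∉ P.edges ∧ s(u, w) ∉ Q.edges :=
    fun u w => removeInt2_adj hP hQ hinP hinQ
  have hDv : ∀ l < n, (l < i ∨ j ≤ l) → (removeInt2 P Q).spanningCoe.Adj (v l) (v (l + 1)) := by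
    intro l hl hlij
    have hH := deleteEdges_adj.mp (hv.adj l hl)
    refine (hD _ _).mpr ⟨hH.1, hH.2, fun he => ?_⟩
    obtain ⟨m, him, hmj, hm⟩ := (hQedge _).mp he
    have := hv.edge_inj (by omega) hl hm
    omega
  have hrx : (removeInt2 P Q).spanningCoe.Reachable x (v i) := by
    obtain ⟨w, -⟩ := exists_segment' v (Nat.zero_le i) fun l _ hl => hDv l (by omega) (.inl hl)
    exact h0 ▸ w.reachable
  have hry : (removeInt2 P Q).spanningCoe.Reachable y (v j) := by
    obtain ⟨w, -⟩ := exists_segment' v hj.le fun l hl hl' => hDv l hl' (.inr hl)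
    exact hn ▸ w.reachable.symm
  have hnr : ¬ (removeInt2 P Q).spanningCoe.Reachable x y := by
    have h := not_reachable_of_not_covered (D := (removeInt2 P Q).spanningCoe)
      (fun u w huw => ?_) (hgap i le_rfl hij) (Nat.zero_le i) (show i < n by omega) le_rfl
    · rwa [h0, hn] at h
    obtain ⟨h, hP', hQ'⟩ := (hD _ _).mp huw
    exact ⟨deleteEdges_adj.mpr ⟨h, hP'⟩, fun he => hQ' ((hQedge _).mpr ⟨i, le_rfl, hij, he.symm⟩)⟩
  have hcomp : ∀ w, w ∉ innSet P → w ∉ innSet Q →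
      (removeInt2 P Q).spanningCoe.Reachable x w ∨
        (removeInt2 P Q).spanningCoe.Reachable y w := by
    intro w hwP hwQ
    obtain ⟨p⟩ := h2.1.preconnected w x
    obtain ⟨t, ht, hr⟩ := exists_reachable_end (D := (removeInt2 P Q).spanningCoe)
      (fun u w h₁ h₂ h₃ => (hD u w).mpr ⟨h₁, h₂, h₃⟩) hinP hinQ p rfl hwP hwQ
    rcases ht with rfl | rfl | rfl | rfl
    · exact .inl hr
    · exact .inr hr
    · exact .inl (hrx.trans hr)
    · exact .inr (hry.trans hr)
  have hBD : ∀ u w, B.Adj u w → (removeInt2 P Q).spanningCoe.Adj u w := by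
    intro u w huw
    have hPB : ∀ s t, B.Adj s t → G.Adj s t ∧ s(s, t) ∉ P.edges := fun s t hst =>
      (removeInt_adj hP hinP).mp (hB.1.2 hst)
    refine (hD _ _).mpr ⟨(hPB _ _ huw).1, (hPB _ _ huw).2, fun he => ?_⟩
    obtain ⟨l, hil, hlj, hl⟩ := (hQedge _).mp he
    have hBl : B.Adj (v l) (v (l + 1)) := by
      rw [← Subgraph.mem_edgeSet] at huw ⊢
      rw [← hl] at huw
      exact huw
    have hr := reachable_of_subgraph_adj hB2 hBl
      (D := (G.deleteEdges {e | e ∈ P.edges}).deleteEdges {seqEdge v l})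
      fun s t hst hne => by
        rw [deleteEdges_adj, deleteEdges_adj]
        exact ⟨hPB _ _ hst, hne⟩
    refine not_reachable_of_not_covered (fun s t hst => ?_) (hgap l hil hlj) le_rfl
      (Nat.lt_succ_self l) (by omega) hr
    rw [deleteEdges_adj] at hst
    exact hst
  refine ⟨v i, v j, Q, ⟨hP, hQ, hlen, by omega, hdisj, hxA, hyA, hiA, hjA, hdx, hdy, hdi, hdj,
    hinner, hQdeg, hrx, hry, hnr, ?_⟩, ?_⟩
  · intro w hw
    have hw' : w ∉ innSet P ∪ innSet Q := hw.2
    rw [Set.mem_union, not_or] at hw'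
    exact hcomp w hw'.1 hw'.2
  · have hreach : ∀ s ∈ B.verts, ∀ t ∈ B.verts, (removeInt2 P Q).spanningCoe.Reachable s t := by
      intro s hs t ht
      let f : B.coe →g (removeInt2 P Q).spanningCoe :=
        { toFun := Subtype.val
          map_rel' := fun h => hBD _ _ h }
      exact (hB2.1.preconnected ⟨s, hs⟩ ⟨t, ht⟩).map f
    obtain ⟨a, b, -, hab, -, -⟩ := hB2.2.1
    have hne : a.1 ≠ b.1 := fun h => hab (Subtype.ext h)
    obtain ⟨p⟩ := hreach a a.2 b b.2
    have hz := (hD _ _).mp (p.adj_snd fun h => hne h.eq)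
    rcases hcomp a (fun h => hz.2.1 (hinP _ h _ hz.1)) (fun h => hz.2.2 (hinQ _ h _ hz.1))
      with h | h
    · exact .inl fun w hw => h.trans (hreach a a.2 w hw)
    · exact .inr fun w hw => h.trans (hreach a a.2 w hw)
end
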